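/- There exist constants Θ ≥ 1 and γ₀, γ₁, c > 0 such that the following holds (existence of a non-equilibrium steady state for the nonlinear BGK model with diffusive boundary conditions). Let κ, T₁, T₂ > 0 satisfy κ²T₁ ≥ Θ, T₂ ≥ T₁, T₂ ≥ √(T₁T₂)(1 + γ₀(κ²T₁)^{−1/4}) and T₁ ≤ √(T₁T₂)(1 − γ₁(κ²T₁)^{−1/4}). Then there exists a measurable function f : [0,1] × ℝ → [0,∞) such that, setting ρ(x) = ∫_ℝ f(x,v) dv and T_f(x) = (∫_ℝ v² f(x,v) dv)/ρ(x): (i) f is a mild steady state of the linear BGK equation with data (κ, T₁, T₂, ρ, T_f) — i.e. f satisfies the stationary nonlinear BGK equation with diffusive boundary conditions in mild form, the Maxwellian on the right-hand side having f's own temperature profile; (ii) ∫₀¹ ρ(x) dx = 1 and 1 − γ₀(κ²T₁)^{−1/4} ≤ ρ(x) ≤ 1 + γ₁(κ²T₁)^{−1/4} for all x; (iii) ∫_ℝ v f(x,v) dv = 0 for all x ∈ [0,1] (zero momentum); (iv) T_f is continuous on [0,1] with T₁ ≤ T_f(x) ≤ T₂ and √(T₁T₂)(1 − c(κ²T₁)^{−1/4})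 ≤ T_f(x) ≤ √(T₁T₂)(1 + c(κ²T₁)^{−1/4}) for all x, and the pressure ρ(x)T_f(x) satisfies c^{-1}√(T₁T₂) ≤ ρ(x)T_f(x) ≤ c√(T₁T₂). -/

import Mathlib

open MeasureTheory Real Set

/-- Centered Maxwellian with temperature `T`: `M_T(v) = (2πT)^{-1/2} exp(−v²/(2T))`. -/
noncomputable def Mxw (T v : ℝ) : ℝ :=
  (Real.sqrt (2 * π * T))⁻¹ * Real.exp (-v ^ 2 / (2 * T))

/-- Wall Maxwellian with temperature `T`: `M̃_T(v) = (1/T) exp(−v²/(2T))`,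
normalized so that `∫₀^∞ v M̃_T(v) dv = 1`. -/
noncomputable def wallMxw (T v : ℝ) : ℝ :=
  T⁻¹ * Real.exp (-v ^ 2 / (2 * T))

/-- `C_i = ∫₀^∞ v e^{−1/(κv)} M̃_{T_i}(v) dv`. -/
noncomputable def Cwall (κ T : ℝ) : ℝ :=
  ∫ v in Ioi (0 : ℝ), v * Real.exp (-1 / (κ * v)) * wallMxw T v

/-- `C₋ = (1/κ) ∫₀¹ ρ(y) (∫₀^∞ e^{−y/(κv)} M_{T(y)}(v) dv) dy`. -/
noncomputable def Cminus (κ : ℝ) (ρ T : ℝ → ℝ) : ℝ :=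
  κ⁻¹ * ∫ y in Icc (0 : ℝ) 1, ρ y * ∫ v in Ioi (0 : ℝ), Real.exp (-y / (κ * v)) * Mxw (T y) v

/-- `C₊ = (1/κ) ∫₀¹ ρ(y) (∫₀^∞ e^{−(1−y)/(κv)} M_{T(y)}(v) dv) dy`. -/
noncomputable def Cplus (κ : ℝ) (ρ T : ℝ → ℝ) : ℝ :=
  κ⁻¹ * ∫ y in Icc (0 : ℝ) 1, ρ y * ∫ v in Ioi (0 : ℝ), Real.exp (-(1 - y) / (κ * v)) * Mxw (T y) v

/-- `f` is a mild steady state of the linear BGK equation with data `(κ, T₁, T₂, ρ, T)`. -/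
def IsMildSteadyState (κ T₁ T₂ : ℝ) (ρ T : ℝ → ℝ) (f : ℝ → ℝ → ℝ) : Prop :=
  Cwall κ T₁ * Cwall κ T₂ < 1 ∧
  IntegrableOn
    (fun y => ρ y * ∫ v in Ioi (0 : ℝ), Real.exp (-y / (κ * v)) * Mxw (T y) v)
    (Icc (0 : ℝ) 1) ∧
  IntegrableOn
    (fun y => ρ y * ∫ v in Ioi (0 : ℝ), Real.exp (-(1 - y) / (κ * v)) * Mxw (T y) v)
    (Icc (0 : ℝ) 1) ∧
  (∀ x ∈ Icc (0 : ℝ) 1, ρ x = ∫ v, f x v) ∧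
  (∀ x ∈ Icc (0 : ℝ) 1,
    (∀ᵐ v ∂(volume.restrict (Ioi (0 : ℝ))),
      f x v = Real.exp (-x / (κ * v)) * wallMxw T₁ v *
          ((Cminus κ ρ T + Cwall κ T₂ * Cplus κ ρ T) / (1 - Cwall κ T₁ * Cwall κ T₂)) +
        ∫ y in (0 : ℝ)..x, (κ * v)⁻¹ * Real.exp (-(x - y) / (κ * v)) * ρ y * Mxw (T y) v) ∧
    (∀ᵐ v ∂(volume.restrict (Iio (0 : ℝ))),
      f x v = Real.exp (-(1 - x) / (κ * |v|)) * wallMxw T₂ v *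
          ((Cplus κ ρ T + Cwall κ T₁ * Cminus κ ρ T) / (1 - Cwall κ T₁ * Cwall κ T₂)) +
        ∫ y in x..1, (κ * |v|)⁻¹ * Real.exp (-(y - x) / (κ * |v|)) * ρ y * Mxw (T y) v))

/-- The unnormalized centered Gaussian with variance `τ`. -/
noncomputable def gauss (τ v : ℝ) : ℝ := Real.exp (-v ^ 2 / (2 * τ))

lemma gauss_pos (τ v : ℝ) : 0 < gauss τ v := Real.exp_pos _

@[fun_prop]
lemma continuous_gauss (τ : ℝ) : Continuous (gauss τ) := by
  unfold gauss; fun_prop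

lemma wallMxw_eq (τ v : ℝ) : wallMxw τ v = τ⁻¹ * gauss τ v := rfl

lemma gauss_eq (τ v : ℝ) : gauss τ v = Real.exp (-(2 * τ)⁻¹ * v ^ 2) := by
  unfold gauss; congr 1; ring

lemma integrableOn_rpow_mul_gauss {τ s : ℝ} (hτ : 0 < τ) (hs : -1 < s) :
    IntegrableOn (fun v => v ^ s * gauss τ v) (Ioi 0) := by
  simp_rw [gauss_eq]
  exact integrableOn_rpow_mul_exp_neg_mul_sq (by positivity) hs

lemma integral_rpow_mul_gauss {τ s : ℝ} (hτ : 0 < τ) (hs : -1 < s) :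
    ∫ v in Ioi (0 : ℝ), v ^ s * gauss τ v =
      (2 * τ) ^ ((s + 1) / 2) * (1 / 2) * Real.Gamma ((s + 1) / 2) := by
  have h := integral_rpow_mul_exp_neg_mul_rpow (p := 2) (q := s) (b := (2 * τ)⁻¹) (by norm_num) hs
    (by positivity)
  simp_rw [Real.rpow_two] at h
  simp_rw [gauss_eq]
  rw [h, Real.inv_rpow (by positivity), neg_div, Real.rpow_neg (by positivity), inv_inv]

lemma integrableOn_gauss {τ : ℝ} (hτ : 0 < τ) : IntegrableOn (gauss τ) (Ioi 0) := by
  simpa using integrableOn_rpow_mul_gauss hτ (s := 0) (by norm_num)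

lemma integrableOn_mul_gauss {τ : ℝ} (hτ : 0 < τ) :
    IntegrableOn (fun v => v * gauss τ v) (Ioi 0) := by
  simpa using integrableOn_rpow_mul_gauss hτ (s := 1) (by norm_num)

lemma integrableOn_sq_mul_gauss {τ : ℝ} (hτ : 0 < τ) :
    IntegrableOn (fun v => v ^ 2 * gauss τ v) (Ioi 0) := by
  simpa using integrableOn_rpow_mul_gauss hτ (s := 2) (by norm_num)

lemma integral_gauss {τ : ℝ} (hτ : 0 < τ) : ∫ v in Ioi (0 : ℝ), gauss τ v = √(π / 2) * √τ := by
  have h := integral_rpow_mul_gauss hτ (s := 0) (by norm_num)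
  simp only [Real.rpow_zero, one_mul, zero_add] at h
  rw [h, Real.Gamma_one_half_eq, ← Real.sqrt_eq_rpow, Real.sqrt_mul (by norm_num),
    Real.sqrt_div pi_pos.le]
  have : √(2 : ℝ) * √2 = 2 := Real.mul_self_sqrt (by norm_num)
  field_simp
  nlinarith

lemma integral_mul_gauss {τ : ℝ} (hτ : 0 < τ) : ∫ v in Ioi (0 : ℝ), v * gauss τ v = τ := by
  have h := integral_rpow_mul_gauss hτ (s := 1) (by norm_num)
  norm_num at h
  rw [h]
  ring

lemma integral_sq_mul_gauss {τ : ℝ} (hτ : 0 < τ) :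
    ∫ v in Ioi (0 : ℝ), v ^ 2 * gauss τ v = τ * (√(π / 2) * √τ) := by
  have h := integral_rpow_mul_gauss hτ (s := 2) (by norm_num)
  have h0 := integral_rpow_mul_gauss hτ (s := 0) (by norm_num)
  have e : ((2 : ℝ) + 1) / 2 = 1 / 2 + 1 := by norm_num
  rw [e, Real.Gamma_add_one (by norm_num), Real.rpow_add (by positivity), Real.rpow_one] at h
  simp only [Real.rpow_two] at h
  simp only [Real.rpow_zero, one_mul, zero_add] at h0
  rw [h, ← integral_gauss hτ, h0]
  ring

lemma one_sub_exp_neg_le_sqrt {s : ℝ} (hs : 0 ≤ s) : 1 - Real.exp (-s) ≤ √s := by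
  rcases le_total s 1 with h | h
  · have h1 := Real.add_one_le_exp (-s)
    have h2 : s ≤ √s := Real.le_sqrt_of_sq_le (by nlinarith)
    linarith
  · have h1 := Real.exp_pos (-s)
    have h2 : 1 ≤ √s := Real.one_le_sqrt.mpr h
    linarith

lemma sqrt_inv_mul_eq {κ v : ℝ} (hκ : 0 < κ) (hv : 0 < v) :
    √((κ * v)⁻¹) = √(κ⁻¹) * v ^ (-(1 : ℝ) / 2) := by
  rw [mul_inv, Real.sqrt_mul (by positivity), Real.sqrt_eq_rpow (v⁻¹), Real.inv_rpow hv.le,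
    ← Real.rpow_neg hv.le]
  norm_num

lemma integrableOn_sqrt_mul_gauss {κ τ : ℝ} (hκ : 0 < κ) (hτ : 0 < τ) :
    IntegrableOn (fun v => √((κ * v)⁻¹) * gauss τ v) (Ioi 0) := by
  refine IntegrableOn.congr_fun ((integrableOn_rpow_mul_gauss hτ (s := -(1 : ℝ) / 2)
    (by norm_num)).const_mul (√(κ⁻¹))) (fun v hv => ?_) measurableSet_Ioi
  simp only [sqrt_inv_mul_eq hκ hv, mul_assoc]

lemma sq_mul_gauss_le {τ : ℝ} (hτ : 0 < τ) (v : ℝ) :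
    v ^ 2 * gauss τ v ≤ 4 * τ * gauss (2 * τ) v := by
  have h : gauss τ v = gauss (2 * τ) v * Real.exp (-(v ^ 2 / (4 * τ))) := by
    unfold gauss
    rw [← Real.exp_add]
    congr 1
    field_simp
    ring
  have h1 : v ^ 2 / (4 * τ) * Real.exp (-(v ^ 2 / (4 * τ))) ≤ 1 := by
    have h2 := Real.add_one_le_exp (v ^ 2 / (4 * τ))
    rw [Real.exp_neg, ← div_eq_mul_inv, div_le_one (Real.exp_pos _)]
    linarith
  rw [h]
  calc v ^ 2 * (gauss (2 * τ) v * Real.exp (-(v ^ 2 / (4 * τ))))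
      = 4 * τ * gauss (2 * τ) v * (v ^ 2 / (4 * τ) * Real.exp (-(v ^ 2 / (4 * τ)))) := by
        field_simp
    _ ≤ 4 * τ * gauss (2 * τ) v * 1 := by
        gcongr
        have := gauss_pos (2 * τ) v
        positivity
    _ = _ := mul_one _

lemma integrableOn_sqrt_mul_sq_mul_gauss {κ τ : ℝ} (hκ : 0 < κ) (hτ : 0 < τ) :
    IntegrableOn (fun v => √((κ * v)⁻¹) * (v ^ 2 * gauss τ v)) (Ioi 0) := by
  refine IntegrableOn.congr_fun ((integrableOn_rpow_mul_gauss hτ (s := (3 : ℝ) / 2)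
    (by norm_num)).const_mul (√(κ⁻¹))) (fun v hv => ?_) measurableSet_Ioi
  have hv' : (0 : ℝ) < v := hv
  have e : v ^ ((3 : ℝ) / 2) = v ^ (-(1 : ℝ) / 2) * v ^ 2 := by
    rw [← Real.rpow_two, ← Real.rpow_add hv']
    norm_num
  simp only [sqrt_inv_mul_eq hκ hv, e, mul_assoc]

/-- Gaussian moments weighted by `(κv)^{-1/2}` are small when `κ√τ` is large. -/
lemma exists_integral_sqrt_mul_gauss_le : ∃ K : ℝ, 1 ≤ K ∧ ∀ κ τ : ℝ, 0 < κ → 0 < τ →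
    ∫ v in Ioi (0 : ℝ), √((κ * v)⁻¹) * gauss τ v ≤ K * √τ * √((κ * √τ)⁻¹) := by
  refine ⟨1 + (2 : ℝ) ^ ((1 : ℝ) / 4) * (1 / 2) * Real.Gamma (1 / 4), ?_, ?_⟩
  · have := Real.Gamma_pos_of_pos (s := 1 / 4) (by norm_num)
    have : (0 : ℝ) ≤ (2 : ℝ) ^ ((1 : ℝ) / 4) * (1 / 2) * Real.Gamma (1 / 4) := by positivity
    linarith
  · intro κ τ hκ hτ
    have h := integral_rpow_mul_gauss hτ (s := -(1 : ℝ) / 2) (by norm_num)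
    have h1 : ∫ v in Ioi (0 : ℝ), √((κ * v)⁻¹) * gauss τ v
        = √(κ⁻¹) * ∫ v in Ioi (0 : ℝ), v ^ (-(1 : ℝ) / 2) * gauss τ v := by
      rw [← integral_const_mul]
      refine setIntegral_congr_fun measurableSet_Ioi (fun v hv => ?_)
      simp only [sqrt_inv_mul_eq hκ hv, mul_assoc]
    have e : ((-(1 : ℝ) / 2 + 1) / 2) = 1 / 4 := by norm_num
    have hs : 0 < √τ := Real.sqrt_pos.mpr hτ
    have e2 : √τ * √((κ * √τ)⁻¹) = √(κ⁻¹) * τ ^ ((1 : ℝ) / 4) := by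
      rw [sqrt_inv_mul_eq hκ hs, Real.sqrt_eq_rpow τ, ← Real.rpow_mul hτ.le, mul_left_comm,
        ← Real.rpow_add hτ]
      norm_num
    rw [h1, h, e, Real.mul_rpow (by norm_num) hτ.le, mul_assoc _ (√τ), e2]
    have : 0 ≤ √(κ⁻¹) * τ ^ ((1 : ℝ) / 4) := by positivity
    nlinarith

/-- The contribution of the source `S` to the distribution of particles moving with speed `v > 0`
away from the wall `x = 0`. -/
noncomputable def gain (κ : ℝ) (S : ℝ → ℝ → ℝ) (x v : ℝ) : ℝ :=
  ∫ y in (0 : ℝ)..x, (κ * v)⁻¹ * Real.exp (-(x - y) / (κ * v)) * S y v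

/-- The flux of particles emitted by the source `S` and hitting the wall `x = 1` without collision. -/
noncomputable def outflow (κ : ℝ) (S : ℝ → ℝ → ℝ) : ℝ :=
  κ⁻¹ * ∫ y in (0 : ℝ)..1, ∫ v in Ioi (0 : ℝ), Real.exp (-(1 - y) / (κ * v)) * S y v

/-- A continuous source dominated, uniformly in space, by `b` times a Gaussian of variance `τ`. -/
structure IsSource (b τ : ℝ) (S : ℝ → ℝ → ℝ) : Prop where
  cont : Continuous (Function.uncurry S)
  bound : ∀ y v, |S y v| ≤ b * gauss τ v

namespace IsSource

variable {b τ κ : ℝ} {S : ℝ → ℝ → ℝ}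

lemma continuous_left (h : IsSource b τ S) (v : ℝ) : Continuous fun y => S y v :=
  h.cont.comp (by fun_prop : Continuous fun y : ℝ => (y, v))

lemma continuous_right (h : IsSource b τ S) (y : ℝ) : Continuous fun v => S y v :=
  h.cont.comp (by fun_prop : Continuous fun v : ℝ => (y, v))

lemma nonneg (h : IsSource b τ S) : 0 ≤ b := by
  by_contra! hb
  have h1 := (abs_nonneg _).trans (h.bound 0 0)
  nlinarith [gauss_pos τ 0]

lemma integrableOn (h : IsSource b τ S) (hτ : 0 < τ) (y : ℝ) :
    IntegrableOn (fun v => S y v) (Ioi 0) :=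
  Integrable.mono' ((integrableOn_gauss hτ).const_mul b) (h.continuous_right y).aestronglyMeasurable
    (ae_of_all _ fun v => h.bound y v)

end IsSource

lemma gain_eq {κ : ℝ} {S : ℝ → ℝ → ℝ} (x v : ℝ) :
    gain κ S x v = Real.exp (-x / (κ * v)) *
      ∫ y in (0 : ℝ)..x, (κ * v)⁻¹ * (Real.exp (y / (κ * v)) * S y v) := by
  unfold gain
  rw [← intervalIntegral.integral_const_mul]
  congr 1
  ext y
  rw [show -(x - y) / (κ * v) = -x / (κ * v) + y / (κ * v) by ring, Real.exp_add]
  ring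

lemma gain_zero (κ : ℝ) (S : ℝ → ℝ → ℝ) (v : ℝ) : gain κ S 0 v = 0 := by
  simp [gain]

lemma hasDerivAt_gain {κ : ℝ} {S : ℝ → ℝ → ℝ} {v : ℝ} (hS : Continuous fun y => S y v) (x : ℝ) :
    HasDerivAt (fun x => gain κ S x v) ((κ * v)⁻¹ * (S x v - gain κ S x v)) x := by
  have hc : Continuous fun y => (κ * v)⁻¹ * (Real.exp (y / (κ * v)) * S y v) := by fun_prop
  have h1 := intervalIntegral.integral_hasDerivAt_right (hc.intervalIntegrable 0 x)
    (hc.stronglyMeasurableAtFilter _ _) hc.continuousAt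
  have h2 : HasDerivAt (fun x => Real.exp (-x / (κ * v)))
      (Real.exp (-x / (κ * v)) * (-1 / (κ * v))) x :=
    ((hasDerivAt_id x).neg.div_const (κ * v)).exp
  have h3 := h2.mul h1
  have e : (fun x => gain κ S x v) = ((fun x => Real.exp (-x / (κ * v))) *
      fun x => ∫ y in (0 : ℝ)..x, (κ * v)⁻¹ * (Real.exp (y / (κ * v)) * S y v)) := by
    ext x
    simp [gain_eq]
  rw [e]
  refine h3.congr_deriv ?_
  rw [gain_eq]
  have e2 : Real.exp (-x / (κ * v)) * Real.exp (x / (κ * v)) = 1 := by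
    rw [← Real.exp_add, ← Real.exp_zero]
    congr 1
    ring
  linear_combination (κ * v)⁻¹ * S x v * e2

lemma measurable_gain {κ : ℝ} {S : ℝ → ℝ → ℝ} (hS : Measurable (Function.uncurry S)) :
    Measurable (Function.uncurry (gain κ S)) := by
  have e : Function.uncurry (gain κ S) = fun p : ℝ × ℝ => p.1 * ∫ s in Ioc (0 : ℝ) 1,
      (κ * p.2)⁻¹ * Real.exp (-(p.1 - p.1 * s) / (κ * p.2)) * S (p.1 * s) p.2 := by
    ext ⟨x, v⟩
    simp only [Function.uncurry, gain]
    have := intervalIntegral.mul_integral_comp_mul_left (a := 0) (b := 1)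
      (f := fun y => (κ * v)⁻¹ * Real.exp (-(x - y) / (κ * v)) * S y v) x
    rw [mul_zero, mul_one, intervalIntegral.integral_of_le zero_le_one] at this
    rw [← this]
  rw [e]
  refine measurable_fst.mul ?_
  have hm : Measurable fun q : (ℝ × ℝ) × ℝ =>
      (κ * q.1.2)⁻¹ * Real.exp (-(q.1.1 - q.1.1 * q.2) / (κ * q.1.2)) * S (q.1.1 * q.2) q.1.2 := by
    have h1 : Measurable fun q : (ℝ × ℝ) × ℝ => S (q.1.1 * q.2) q.1.2 :=
      hS.comp (by fun_prop : Measurable fun q : (ℝ × ℝ) × ℝ => (q.1.1 * q.2, q.1.2))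
    fun_prop
  exact (hm.stronglyMeasurable.integral_prod_right (ν := volume.restrict (Ioc (0 : ℝ) 1))).measurable

lemma gain_const {κ : ℝ} (c x v : ℝ) :
    gain κ (fun _ _ => c) x v = c * (1 - Real.exp (-x / (κ * v))) := by
  have h1 : ∀ y ∈ uIcc 0 x, HasDerivAt (fun y => c * Real.exp (-(x - y) / (κ * v)))
      ((κ * v)⁻¹ * Real.exp (-(x - y) / (κ * v)) * c) y := by
    intro y _
    have h2 : HasDerivAt (fun y => -(x - y) / (κ * v)) (1 / (κ * v)) y := by
      have := ((hasDerivAt_id y).const_sub x).neg.div_const (κ * v)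
      simpa using this
    refine (h2.exp.const_mul c).congr_deriv ?_
    ring
  have h3 := intervalIntegral.integral_eq_sub_of_hasDerivAt h1
    (Continuous.intervalIntegrable (by fun_prop) _ _)
  unfold gain
  rw [h3]
  simp
  ring

lemma abs_gain_le {κ : ℝ} {S : ℝ → ℝ → ℝ} {x v c : ℝ} (hκ : 0 < κ) (hv : 0 < v) (hx : 0 ≤ x)
    (hS : ∀ y, |S y v| ≤ c) :
    |gain κ S x v| ≤ c * (1 - Real.exp (-x / (κ * v))) := by
  rw [← gain_const c x v, ← Real.norm_eq_abs]
  unfold gain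
  refine intervalIntegral.norm_integral_le_of_norm_le hx (ae_of_all _ fun y _ => ?_) ?_
  · rw [Real.norm_eq_abs, abs_mul, abs_of_pos (by positivity)]
    exact mul_le_mul_of_nonneg_left (hS y) (by positivity)
  · exact Continuous.intervalIntegrable (by fun_prop) _ _

lemma one_sub_exp_le {κ x v : ℝ} (hκ : 0 < κ) (hv : 0 < v) (hx : 0 ≤ x) (hx1 : x ≤ 1) :
    1 - Real.exp (-x / (κ * v)) ≤ √((κ * v)⁻¹) := by
  have h : -x / (κ * v) = -(x / (κ * v)) := neg_div _ _
  rw [h]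
  refine (one_sub_exp_neg_le_sqrt (by positivity)).trans (Real.sqrt_le_sqrt ?_)
  rw [← one_div]
  gcongr

lemma exp_neg_div_le_one {κ x v : ℝ} (hκ : 0 < κ) (hv : 0 < v) (hx : 0 ≤ x) :
    Real.exp (-x / (κ * v)) ≤ 1 := by
  rw [Real.exp_le_one_iff, neg_div]
  have : 0 ≤ x / (κ * v) := by positivity
  linarith

lemma gain_nonneg {κ : ℝ} {S : ℝ → ℝ → ℝ} {x v : ℝ} (hκ : 0 < κ) (hv : 0 < v) (hx : 0 ≤ x)
    (hS : ∀ y, 0 ≤ S y v) : 0 ≤ gain κ S x v := by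
  refine intervalIntegral.integral_nonneg hx fun y _ => ?_
  have := hS y
  positivity

lemma gain_sub {κ : ℝ} {S S' : ℝ → ℝ → ℝ} {v : ℝ} (hS : Continuous fun y => S y v)
    (hS' : Continuous fun y => S' y v) (x : ℝ) :
    gain κ (fun y v => S y v - S' y v) x v = gain κ S x v - gain κ S' x v := by
  unfold gain
  rw [← intervalIntegral.integral_sub (Continuous.intervalIntegrable (by fun_prop) _ _)
    (Continuous.intervalIntegrable (by fun_prop) _ _)]
  simp only [mul_sub]

lemma integrable_prod_of_bound {g : ℝ → ℝ → ℝ} {Q : ℝ → ℝ} {x : ℝ}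
    (hg : Measurable (Function.uncurry g)) (hQ : IntegrableOn Q (Ioi 0))
    (h : ∀ y ∈ Ioc 0 x, ∀ v ∈ Ioi (0 : ℝ), |g y v| ≤ Q v) :
    Integrable (Function.uncurry g)
      ((volume.restrict (Ioc 0 x)).prod (volume.restrict (Ioi (0 : ℝ)))) := by
  have h1 : Integrable (fun p : ℝ × ℝ => Q p.2)
      ((volume.restrict (Ioc 0 x)).prod (volume.restrict (Ioi (0 : ℝ)))) :=
    hQ.comp_snd _
  refine h1.mono' hg.aestronglyMeasurable ?_
  rw [Measure.prod_restrict]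
  refine ae_restrict_of_forall_mem (measurableSet_Ioc.prod measurableSet_Ioi) fun p hp => ?_
  exact h p.1 hp.1 p.2 hp.2

lemma integral_swap_of_bound {g : ℝ → ℝ → ℝ} {Q : ℝ → ℝ} {x : ℝ} (hx : 0 ≤ x)
    (hg : Measurable (Function.uncurry g)) (hQ : IntegrableOn Q (Ioi 0))
    (h : ∀ y ∈ Ioc 0 x, ∀ v ∈ Ioi (0 : ℝ), |g y v| ≤ Q v) :
    ∫ y in (0 : ℝ)..x, ∫ v in Ioi (0 : ℝ), g y v =
      ∫ v in Ioi (0 : ℝ), ∫ y in (0 : ℝ)..x, g y v := by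
  simp only [intervalIntegral.integral_of_le hx]
  exact integral_integral_swap (integrable_prod_of_bound hg hQ h)

lemma intervalIntegrable_of_bound {g : ℝ → ℝ → ℝ} {Q : ℝ → ℝ} {x : ℝ} (hx : 0 ≤ x)
    (hg : Measurable (Function.uncurry g)) (hQ : IntegrableOn Q (Ioi 0))
    (h : ∀ y ∈ Ioc 0 x, ∀ v ∈ Ioi (0 : ℝ), |g y v| ≤ Q v) :
    IntervalIntegrable (fun y => ∫ v in Ioi (0 : ℝ), g y v) volume 0 x := by
  rw [intervalIntegrable_iff_integrableOn_Ioc_of_le hx]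
  exact (integrable_prod_of_bound hg hQ h).integral_prod_left

/-- The distribution of particles moving away from the wall `x = 0`, which emits them with flux `A`
at temperature `τ`, in the presence of the source `S`. -/
noncomputable def half (κ τ A : ℝ) (S : ℝ → ℝ → ℝ) (x v : ℝ) : ℝ :=
  A * (Real.exp (-x / (κ * v)) * wallMxw τ v) + gain κ S x v

lemma integrableOn_mul_exp_mul_gauss {κ τ x : ℝ} {φ : ℝ → ℝ} (hκ : 0 < κ) (hx : 0 ≤ x)
    (hφ : Measurable φ) (hi : IntegrableOn (fun v => φ v * gauss τ v) (Ioi 0)) :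
    IntegrableOn (fun v => φ v * (Real.exp (-x / (κ * v)) * gauss τ v)) (Ioi 0) := by
  refine Integrable.mono hi ?_ (ae_restrict_of_forall_mem measurableSet_Ioi fun v hv => ?_)
  · have : Measurable (gauss τ) := (continuous_gauss τ).measurable
    exact Measurable.aestronglyMeasurable (by fun_prop)
  · have h1 := exp_neg_div_le_one hκ hv hx
    rw [norm_mul, norm_mul, norm_mul, Real.norm_of_nonneg (Real.exp_pos _).le]
    gcongr
    exact mul_le_of_le_one_left (norm_nonneg _) h1

lemma integral_mul_exp_mul_gauss_le {κ τ x : ℝ} {φ : ℝ → ℝ} (hκ : 0 < κ) (hx : 0 ≤ x)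
    (hφ : Measurable φ) (hφ0 : ∀ v ∈ Ioi (0 : ℝ), 0 ≤ φ v)
    (hi : IntegrableOn (fun v => φ v * gauss τ v) (Ioi 0)) :
    ∫ v in Ioi (0 : ℝ), φ v * (Real.exp (-x / (κ * v)) * gauss τ v) ≤
      ∫ v in Ioi (0 : ℝ), φ v * gauss τ v := by
  refine setIntegral_mono_on (integrableOn_mul_exp_mul_gauss hκ hx hφ hi) hi measurableSet_Ioi
    fun v hv => ?_
  have h1 := exp_neg_div_le_one hκ hv hx
  exact mul_le_mul_of_nonneg_left (mul_le_of_le_one_left (gauss_pos τ v).le h1) (hφ0 v hv)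

lemma le_integral_mul_exp_mul_gauss {κ τ x : ℝ} {φ : ℝ → ℝ} (hκ : 0 < κ) (hx : 0 ≤ x) (hx1 : x ≤ 1)
    (hφ : Measurable φ) (hφ0 : ∀ v ∈ Ioi (0 : ℝ), 0 ≤ φ v)
    (hi : IntegrableOn (fun v => φ v * gauss τ v) (Ioi 0))
    (hi' : IntegrableOn (fun v => √((κ * v)⁻¹) * (φ v * gauss τ v)) (Ioi 0)) :
    (∫ v in Ioi (0 : ℝ), φ v * gauss τ v) -
        ∫ v in Ioi (0 : ℝ), √((κ * v)⁻¹) * (φ v * gauss τ v) ≤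
      ∫ v in Ioi (0 : ℝ), φ v * (Real.exp (-x / (κ * v)) * gauss τ v) := by
  rw [← integral_sub hi hi']
  refine setIntegral_mono_on (hi.sub hi') (integrableOn_mul_exp_mul_gauss hκ hx hφ hi)
    measurableSet_Ioi fun v hv => ?_
  have h1 := one_sub_exp_le hκ hv hx hx1
  have h2 := mul_nonneg (hφ0 v hv) (gauss_pos τ v).le
  nlinarith

lemma Cwall_eq (κ τ : ℝ) :
    Cwall κ τ = τ⁻¹ * ∫ v in Ioi (0 : ℝ), v * (Real.exp (-1 / (κ * v)) * gauss τ v) := by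
  unfold Cwall
  rw [← integral_const_mul]
  congr 1
  ext v
  rw [wallMxw_eq]
  ring

lemma one_sub_Cwall_eq {κ τ : ℝ} (hκ : 0 < κ) (hτ : 0 < τ) :
    κ * (1 - Cwall κ τ) =
      τ⁻¹ * ∫ v in Ioi (0 : ℝ), κ * v * (1 - Real.exp (-1 / (κ * v))) * gauss τ v := by
  have h1 := integrableOn_mul_gauss hτ
  have h2 := integrableOn_mul_exp_mul_gauss (φ := fun v => v) hκ zero_le_one measurable_id' h1
  have h3 : ∫ v in Ioi (0 : ℝ), κ * v * (1 - Real.exp (-1 / (κ * v))) * gauss τ v =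
      κ * ((∫ v in Ioi (0 : ℝ), v * gauss τ v) -
        ∫ v in Ioi (0 : ℝ), v * (Real.exp (-1 / (κ * v)) * gauss τ v)) := by
    rw [← integral_sub h1 h2, ← integral_const_mul]
    congr 1
    ext v
    ring
  rw [h3, integral_mul_gauss hτ, Cwall_eq]
  field_simp

lemma integrableOn_one_sub_exp {κ τ : ℝ} (hκ : 0 < κ) (hτ : 0 < τ) :
    IntegrableOn (fun v => κ * v * (1 - Real.exp (-1 / (κ * v))) * gauss τ v) (Ioi 0) := by
  have h1 := integrableOn_mul_gauss hτ
  have h2 := integrableOn_mul_exp_mul_gauss (φ := fun v => v) hκ zero_le_one measurable_id' h1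
  refine Integrable.congr ((h1.sub h2).const_mul κ) (ae_of_all _ fun v => ?_)
  simp only [Pi.sub_apply]
  ring

lemma one_sub_Cwall_le {κ τ : ℝ} (hκ : 0 < κ) (hτ : 0 < τ) :
    κ * (1 - Cwall κ τ) ≤ τ⁻¹ * (√(π / 2) * √τ) := by
  rw [one_sub_Cwall_eq hκ hτ, ← integral_gauss hτ]
  refine mul_le_mul_of_nonneg_left ?_ (by positivity)
  refine setIntegral_mono_on (integrableOn_one_sub_exp hκ hτ) (integrableOn_gauss hτ)
    measurableSet_Ioi fun v hv => ?_
  have hv' : (0 : ℝ) < v := hv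
  refine mul_le_of_le_one_left (gauss_pos τ v).le ?_
  have h1 := Real.add_one_le_exp (-1 / (κ * v))
  have h2 : κ * v * (-1 / (κ * v)) = -1 := by field_simp
  nlinarith [mul_pos hκ hv']

lemma le_one_sub_Cwall {κ τ : ℝ} (hκ : 0 < κ) (hτ : 0 < τ) :
    τ⁻¹ * ∫ v in Ioi (0 : ℝ), Real.exp (-1 / (κ * v)) * gauss τ v ≤ κ * (1 - Cwall κ τ) := by
  rw [one_sub_Cwall_eq hκ hτ]
  have h0 := integrableOn_mul_exp_mul_gauss (τ := τ) (φ := fun _ => 1) hκ zero_le_one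
    measurable_const (by simpa using integrableOn_gauss hτ)
  simp only [one_mul] at h0
  refine mul_le_mul_of_nonneg_left ?_ (by positivity)
  refine setIntegral_mono_on h0 (integrableOn_one_sub_exp hκ hτ)
    measurableSet_Ioi fun v hv => ?_
  have hv' : (0 : ℝ) < v := hv
  have hp := mul_pos hκ hv'
  refine mul_le_mul_of_nonneg_right ?_ (gauss_pos τ v).le
  have h1 := Real.add_one_le_exp (1 / (κ * v))
  have h2 : κ * v * (1 / (κ * v)) = 1 := by field_simp
  have h3 : Real.exp (-1 / (κ * v)) * Real.exp (1 / (κ * v)) = 1 := by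
    rw [← Real.exp_add, neg_div, neg_add_cancel, Real.exp_zero]
  have h4 := Real.exp_pos (-1 / (κ * v))
  have h5 : Real.exp (-1 / (κ * v)) * (1 / (κ * v)) ≤ 1 - Real.exp (-1 / (κ * v)) := by
    nlinarith
  nlinarith [mul_le_mul_of_nonneg_left h5 hp.le]

namespace IsSource

variable {b σ κ : ℝ} {S : ℝ → ℝ → ℝ}

lemma measurable_gain (h : IsSource b σ S) (x : ℝ) : Measurable fun v => gain κ S x v :=
  (_root_.measurable_gain h.cont.measurable).comp (by fun_prop : Measurable fun v : ℝ => (x, v))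

lemma abs_gain_le_gauss (h : IsSource b σ S) (hκ : 0 < κ) {x v : ℝ} (hx : 0 ≤ x) (hv : 0 < v) :
    |gain κ S x v| ≤ b * gauss σ v := by
  refine (abs_gain_le hκ hv hx (fun y => h.bound y v)).trans ?_
  have h1 := Real.exp_pos (-x / (κ * v))
  have h2 := mul_nonneg h.nonneg (gauss_pos σ v).le
  nlinarith

lemma abs_gain_le_sqrt (h : IsSource b σ S) (hκ : 0 < κ) {x v : ℝ} (hx : 0 ≤ x) (hx1 : x ≤ 1)
    (hv : 0 < v) : |gain κ S x v| ≤ b * (√((κ * v)⁻¹) * gauss σ v) := by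
  refine (abs_gain_le hκ hv hx (fun y => h.bound y v)).trans ?_
  have h1 := one_sub_exp_le hκ hv hx hx1
  have h2 := mul_nonneg h.nonneg (gauss_pos σ v).le
  nlinarith

lemma integrableOn_mul_gain (h : IsSource b σ S) (hκ : 0 < κ) {x : ℝ} (hx : 0 ≤ x) {φ : ℝ → ℝ}
    (hφ : Measurable φ) (hi : IntegrableOn (fun v => φ v * gauss σ v) (Ioi 0)) :
    IntegrableOn (fun v => φ v * gain κ S x v) (Ioi 0) := by
  refine Integrable.mono (hi.const_mul b) (hφ.mul (h.measurable_gain x)).aestronglyMeasurable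
    (ae_restrict_of_forall_mem measurableSet_Ioi fun v hv => ?_)
  have h1 := h.abs_gain_le_gauss hκ hx hv
  rw [norm_mul, norm_mul, norm_mul, Real.norm_of_nonneg h.nonneg,
    Real.norm_of_nonneg (gauss_pos σ v).le, mul_left_comm]
  exact mul_le_mul_of_nonneg_left h1 (norm_nonneg _)

lemma abs_integral_mul_gain_le (h : IsSource b σ S) (hκ : 0 < κ) {x : ℝ} (hx : 0 ≤ x) (hx1 : x ≤ 1)
    {φ : ℝ → ℝ} (hφ0 : ∀ v ∈ Ioi (0 : ℝ), 0 ≤ φ v)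
    (hi : IntegrableOn (fun v => √((κ * v)⁻¹) * (φ v * gauss σ v)) (Ioi 0)) :
    |∫ v in Ioi (0 : ℝ), φ v * gain κ S x v| ≤
      b * ∫ v in Ioi (0 : ℝ), √((κ * v)⁻¹) * (φ v * gauss σ v) := by
  rw [← integral_const_mul, ← Real.norm_eq_abs]
  refine norm_integral_le_of_norm_le (hi.const_mul b)
    (ae_restrict_of_forall_mem measurableSet_Ioi fun v hv => ?_)
  have h1 := h.abs_gain_le_sqrt hκ hx hx1 hv
  rw [norm_mul, Real.norm_of_nonneg (hφ0 v hv), Real.norm_eq_abs]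
  refine (mul_le_mul_of_nonneg_left h1 (hφ0 v hv)).trans_eq ?_
  ring

lemma measurable_exp_mul (h : IsSource b σ S) :
    Measurable (Function.uncurry fun y v => Real.exp (-(1 - y) / (κ * v)) * S y v) := by
  have := h.cont.measurable
  have h1 : Measurable fun p : ℝ × ℝ => Real.exp (-(1 - p.1) / (κ * p.2)) := by fun_prop
  exact h1.mul this

lemma abs_exp_mul_le (h : IsSource b σ S) (hκ : 0 < κ) {y v : ℝ} (hy : y ≤ 1) (hv : 0 < v) :
    |Real.exp (-(1 - y) / (κ * v)) * S y v| ≤ b * gauss σ v := by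
  rw [abs_mul, abs_of_pos (Real.exp_pos _)]
  have h1 := exp_neg_div_le_one hκ hv (x := 1 - y) (by linarith)
  exact (mul_le_of_le_one_left (abs_nonneg _) h1).trans (h.bound y v)

lemma integrableOn_exp_mul (h : IsSource b σ S) (hκ : 0 < κ) (hσ : 0 < σ) {y : ℝ} (hy : y ≤ 1) :
    IntegrableOn (fun v => Real.exp (-(1 - y) / (κ * v)) * S y v) (Ioi 0) :=
  Integrable.mono' ((integrableOn_gauss hσ).const_mul b)
    (h.measurable_exp_mul.comp (by fun_prop : Measurable fun v : ℝ => (y, v))).aestronglyMeasurable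
    (ae_restrict_of_forall_mem measurableSet_Ioi fun _ hv => h.abs_exp_mul_le hκ hy hv)

lemma intervalIntegrable_exp_mul (h : IsSource b σ S) (hκ : 0 < κ) (hσ : 0 < σ) :
    IntervalIntegrable (fun y => ∫ v in Ioi (0 : ℝ), Real.exp (-(1 - y) / (κ * v)) * S y v)
      volume 0 1 :=
  intervalIntegrable_of_bound zero_le_one h.measurable_exp_mul ((integrableOn_gauss hσ).const_mul b)
    fun _ hy _ hv => h.abs_exp_mul_le hκ hy.2 hv

lemma intervalIntegrable_integral (h : IsSource b σ S) (hσ : 0 < σ) {x : ℝ} (hx : 0 ≤ x) :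
    IntervalIntegrable (fun y => ∫ v in Ioi (0 : ℝ), S y v) volume 0 x :=
  intervalIntegrable_of_bound hx h.cont.measurable ((integrableOn_gauss hσ).const_mul b)
    fun y _ v _ => h.bound y v

lemma abs_outflow_sub_le (h : IsSource b σ S) (hκ : 0 < κ) (hσ : 0 < σ) :
    |κ * outflow κ S - ∫ y in (0 : ℝ)..1, ∫ v in Ioi (0 : ℝ), S y v| ≤
      b * ∫ v in Ioi (0 : ℝ), √((κ * v)⁻¹) * gauss σ v := by
  unfold outflow
  rw [mul_inv_cancel_left₀ hκ.ne', ← intervalIntegral.integral_sub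
    (h.intervalIntegrable_exp_mul hκ hσ) (h.intervalIntegrable_integral hσ zero_le_one),
    ← Real.norm_eq_abs]
  refine (intervalIntegral.norm_integral_le_of_norm_le_const
    (C := b * ∫ v in Ioi (0 : ℝ), √((κ * v)⁻¹) * gauss σ v) fun y hy => ?_).trans_eq (by simp)
  rw [uIoc_of_le zero_le_one] at hy
  rw [← integral_sub (h.integrableOn_exp_mul hκ hσ hy.2) (h.integrableOn hσ y),
    ← integral_const_mul]
  refine norm_integral_le_of_norm_le ((integrableOn_sqrt_mul_gauss hκ hσ).const_mul b)
    (ae_restrict_of_forall_mem measurableSet_Ioi fun v hv => ?_)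
  have h1 := one_sub_exp_le hκ hv (x := 1 - y) (by linarith [hy.2]) (by linarith [hy.1])
  have h2 := exp_neg_div_le_one hκ hv (x := 1 - y) (by linarith [hy.2])
  have h3 := h.bound y v
  rw [← sub_one_mul, norm_mul, Real.norm_of_nonpos (by linarith), Real.norm_eq_abs]
  calc -(Real.exp (-(1 - y) / (κ * v)) - 1) * |S y v|
      ≤ √((κ * v)⁻¹) * (b * gauss σ v) := by
        gcongr
        linarith
    _ = _ := by ring

lemma outflow_sub {b' σ' : ℝ} {S' : ℝ → ℝ → ℝ} (h : IsSource b σ S) (h' : IsSource b' σ' S')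
    (hκ : 0 < κ) (hσ : 0 < σ) (hσ' : 0 < σ') :
    outflow κ (fun y v => S y v - S' y v) = outflow κ S - outflow κ S' := by
  unfold outflow
  rw [← mul_sub, ← intervalIntegral.integral_sub (h.intervalIntegrable_exp_mul hκ hσ)
    (h'.intervalIntegrable_exp_mul hκ hσ')]
  congr 1
  refine intervalIntegral.integral_congr fun y hy => ?_
  rw [uIcc_of_le zero_le_one] at hy
  simp only [← integral_sub (h.integrableOn_exp_mul hκ hσ hy.2)
    (h'.integrableOn_exp_mul hκ hσ' hy.2), mul_sub]

lemma integral_mul_gain_one (h : IsSource b σ S) (hκ : 0 < κ) (hσ : 0 < σ) :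
    ∫ v in Ioi (0 : ℝ), v * gain κ S 1 v = outflow κ S := by
  unfold outflow
  rw [integral_swap_of_bound zero_le_one h.measurable_exp_mul ((integrableOn_gauss hσ).const_mul b)
    fun _ hy _ hv => h.abs_exp_mul_le hκ hy.2 hv, ← integral_const_mul]
  refine setIntegral_congr_fun measurableSet_Ioi fun v hv => ?_
  have hv' : (0 : ℝ) < v := hv
  simp only [gain]
  rw [← intervalIntegral.integral_const_mul, ← intervalIntegral.integral_const_mul]
  congr 1
  ext y
  field_simp

end IsSource

lemma hasDerivAt_half {κ τ A : ℝ} {S : ℝ → ℝ → ℝ} {v : ℝ} (hS : Continuous fun y => S y v) (x : ℝ) :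
    HasDerivAt (fun x => half κ τ A S x v) ((κ * v)⁻¹ * (S x v - half κ τ A S x v)) x := by
  have h2 : HasDerivAt (fun x => Real.exp (-x / (κ * v)))
      (Real.exp (-x / (κ * v)) * (-1 / (κ * v))) x :=
    ((hasDerivAt_id x).neg.div_const (κ * v)).exp
  refine (((h2.mul_const (wallMxw τ v)).const_mul A).add (hasDerivAt_gain hS x)).congr_deriv ?_
  unfold half
  ring

lemma continuous_half {κ τ A : ℝ} {S : ℝ → ℝ → ℝ} {v : ℝ} (hS : Continuous fun y => S y v) :
    Continuous fun x => half κ τ A S x v :=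
  continuous_iff_continuousAt.2 fun x => (hasDerivAt_half hS x).continuousAt

lemma half_zero (κ τ A : ℝ) (S : ℝ → ℝ → ℝ) (v : ℝ) : half κ τ A S 0 v = A * wallMxw τ v := by
  simp [half, gain_zero]

@[fun_prop]
lemma continuous_wallMxw (τ : ℝ) : Continuous (wallMxw τ) := by
  unfold wallMxw; fun_prop

lemma wallMxw_pos {τ : ℝ} (hτ : 0 < τ) (v : ℝ) : 0 < wallMxw τ v := by
  unfold wallMxw; positivity

lemma half_nonneg {κ τ A : ℝ} {S : ℝ → ℝ → ℝ} {x v : ℝ} (hκ : 0 < κ) (hτ : 0 < τ) (hA : 0 ≤ A)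
    (hv : 0 < v) (hx : 0 ≤ x) (hS : ∀ y, 0 ≤ S y v) : 0 ≤ half κ τ A S x v := by
  have h1 := gain_nonneg hκ hv hx hS
  have h2 := wallMxw_pos hτ v
  unfold half
  positivity

lemma measurable_half {κ τ A : ℝ} {S : ℝ → ℝ → ℝ} (hS : Measurable (Function.uncurry S)) :
    Measurable (Function.uncurry (half κ τ A S)) := by
  have h1 : Measurable fun p : ℝ × ℝ => A * (Real.exp (-p.1 / (κ * p.2)) * wallMxw τ p.2) := by
    have := (continuous_wallMxw τ).measurable
    fun_prop
  exact h1.add (measurable_gain hS)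

namespace IsSource

variable {b σ κ τ A : ℝ} {S : ℝ → ℝ → ℝ} {φ : ℝ → ℝ}

lemma abs_half_le (h : IsSource b σ S) (hκ : 0 < κ) (hτ : 0 < τ) {x v : ℝ} (hx : 0 ≤ x)
    (hv : 0 < v) : |half κ τ A S x v| ≤ |A| * wallMxw τ v + b * gauss σ v := by
  unfold half
  refine (abs_add_le _ _).trans (add_le_add ?_ (h.abs_gain_le_gauss hκ hx hv))
  have h1 := exp_neg_div_le_one hκ hv hx
  rw [abs_mul, abs_of_pos (mul_pos (Real.exp_pos _) (wallMxw_pos hτ v))]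
  gcongr
  exact mul_le_of_le_one_left (wallMxw_pos hτ v).le h1

lemma integrableOn_envelope (hi : IntegrableOn (fun v => φ v * gauss τ v) (Ioi 0))
    (hi' : IntegrableOn (fun v => φ v * gauss σ v) (Ioi 0)) :
    IntegrableOn (fun v => φ v * (|A| * wallMxw τ v + b * gauss σ v)) (Ioi 0) := by
  refine ((hi.const_mul (|A| * τ⁻¹)).add (hi'.const_mul b)).congr (ae_of_all _ fun v => ?_)
  simp only [wallMxw_eq, Pi.add_apply]
  ring

lemma integrableOn_mul_half (h : IsSource b σ S) (hκ : 0 < κ) (hτ : 0 < τ) {x : ℝ} (hx : 0 ≤ x)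
    (hφ : Measurable φ) (hφ0 : ∀ v ∈ Ioi (0 : ℝ), 0 ≤ φ v)
    (hi : IntegrableOn (fun v => φ v * gauss τ v) (Ioi 0))
    (hi' : IntegrableOn (fun v => φ v * gauss σ v) (Ioi 0)) :
    IntegrableOn (fun v => φ v * half κ τ A S x v) (Ioi 0) := by
  refine Integrable.mono' (integrableOn_envelope (A := A) (b := b) hi hi') ?_
    (ae_restrict_of_forall_mem measurableSet_Ioi fun v hv => ?_)
  · exact (hφ.mul ((measurable_half h.cont.measurable).comp
      (by fun_prop : Measurable fun v : ℝ => (x, v)))).aestronglyMeasurable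
  · rw [norm_mul, Real.norm_of_nonneg (hφ0 v hv)]
    exact mul_le_mul_of_nonneg_left (h.abs_half_le hκ hτ hx hv) (hφ0 v hv)

lemma continuousOn_integral_mul_half (h : IsSource b σ S) (hκ : 0 < κ) (hτ : 0 < τ)
    (hφ : Measurable φ) (hφ0 : ∀ v ∈ Ioi (0 : ℝ), 0 ≤ φ v)
    (hi : IntegrableOn (fun v => φ v * gauss τ v) (Ioi 0))
    (hi' : IntegrableOn (fun v => φ v * gauss σ v) (Ioi 0)) :
    ContinuousOn (fun x => ∫ v in Ioi (0 : ℝ), φ v * half κ τ A S x v) (Ici 0) := by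
  refine continuousOn_of_dominated (fun x hx =>
    (h.integrableOn_mul_half hκ hτ hx hφ hφ0 hi hi').aestronglyMeasurable)
    (fun x hx => ae_restrict_of_forall_mem measurableSet_Ioi fun v hv => ?_)
    (integrableOn_envelope (A := A) (b := b) hi hi') (ae_of_all _ fun v => ?_)
  · rw [norm_mul, Real.norm_of_nonneg (hφ0 v hv)]
    exact mul_le_mul_of_nonneg_left (h.abs_half_le hκ hτ hx hv) (hφ0 v hv)
  · exact ((continuous_half (h.continuous_left v)).const_mul _).continuousOn

lemma integrableOn_half (h : IsSource b σ S) (hκ : 0 < κ) (hτ : 0 < τ) (hσ : 0 < σ) {x : ℝ}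
    (hx : 0 ≤ x) : IntegrableOn (fun v => half κ τ A S x v) (Ioi 0) := by
  simpa using h.integrableOn_mul_half (φ := fun _ => 1) hκ hτ hx measurable_const
    (fun _ _ => zero_le_one) (by simpa using integrableOn_gauss hτ)
    (by simpa using integrableOn_gauss hσ)

lemma integrableOn_id_mul_half (h : IsSource b σ S) (hκ : 0 < κ) (hτ : 0 < τ) (hσ : 0 < σ) {x : ℝ}
    (hx : 0 ≤ x) : IntegrableOn (fun v => v * half κ τ A S x v) (Ioi 0) :=
  h.integrableOn_mul_half (φ := fun v => v) hκ hτ hx measurable_id' (fun _ hv => le_of_lt hv)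
    (integrableOn_mul_gauss hτ) (integrableOn_mul_gauss hσ)

lemma integrableOn_sq_mul_half (h : IsSource b σ S) (hκ : 0 < κ) (hτ : 0 < τ) (hσ : 0 < σ) {x : ℝ}
    (hx : 0 ≤ x) : IntegrableOn (fun v => v ^ 2 * half κ τ A S x v) (Ioi 0) :=
  h.integrableOn_mul_half (φ := fun v => v ^ 2) hκ hτ hx (by fun_prop) (fun _ _ => sq_nonneg _)
    (integrableOn_sq_mul_gauss hτ) (integrableOn_sq_mul_gauss hσ)

lemma continuousOn_integral_half (h : IsSource b σ S) (hκ : 0 < κ) (hτ : 0 < τ) (hσ : 0 < σ) :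
    ContinuousOn (fun x => ∫ v in Ioi (0 : ℝ), half κ τ A S x v) (Ici 0) := by
  simpa using h.continuousOn_integral_mul_half (φ := fun _ => 1) (A := A) hκ hτ measurable_const
    (fun _ _ => zero_le_one) (by simpa using integrableOn_gauss hτ)
    (by simpa using integrableOn_gauss hσ)

lemma continuousOn_integral_sq_mul_half (h : IsSource b σ S) (hκ : 0 < κ) (hτ : 0 < τ)
    (hσ : 0 < σ) :
    ContinuousOn (fun x => ∫ v in Ioi (0 : ℝ), v ^ 2 * half κ τ A S x v) (Ici 0) :=
  h.continuousOn_integral_mul_half (φ := fun v => v ^ 2) hκ hτ (by fun_prop)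
    (fun _ _ => sq_nonneg _) (integrableOn_sq_mul_gauss hτ) (integrableOn_sq_mul_gauss hσ)

lemma integral_mul_half (h : IsSource b σ S) (hκ : 0 < κ) {x : ℝ} (hx : 0 ≤ x)
    (hφ : Measurable φ) (hi : IntegrableOn (fun v => φ v * gauss τ v) (Ioi 0))
    (hi' : IntegrableOn (fun v => φ v * gauss σ v) (Ioi 0)) :
    ∫ v in Ioi (0 : ℝ), φ v * half κ τ A S x v =
      A * τ⁻¹ * (∫ v in Ioi (0 : ℝ), φ v * (Real.exp (-x / (κ * v)) * gauss τ v)) +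
        ∫ v in Ioi (0 : ℝ), φ v * gain κ S x v := by
  have h1 := integrableOn_mul_exp_mul_gauss hκ hx hφ hi
  have h2 := h.integrableOn_mul_gain hκ hx hφ hi'
  rw [← integral_const_mul, ← integral_add (h1.const_mul _) h2]
  congr 1
  ext v
  simp only [half, wallMxw_eq]
  ring

lemma integral_half (h : IsSource b σ S) (hκ : 0 < κ) (hτ : 0 < τ) (hσ : 0 < σ) {x : ℝ}
    (hx : 0 ≤ x) :
    ∫ v in Ioi (0 : ℝ), half κ τ A S x v =
      A * τ⁻¹ * (∫ v in Ioi (0 : ℝ), Real.exp (-x / (κ * v)) * gauss τ v) +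
        ∫ v in Ioi (0 : ℝ), gain κ S x v := by
  simpa using h.integral_mul_half (φ := fun _ => 1) (τ := τ) (A := A) hκ hx measurable_const
    (by simpa using integrableOn_gauss hτ) (by simpa using integrableOn_gauss hσ)

lemma integral_sq_mul_half (h : IsSource b σ S) (hκ : 0 < κ) (hτ : 0 < τ) (hσ : 0 < σ) {x : ℝ}
    (hx : 0 ≤ x) :
    ∫ v in Ioi (0 : ℝ), v ^ 2 * half κ τ A S x v =
      A * τ⁻¹ * (∫ v in Ioi (0 : ℝ), v ^ 2 * (Real.exp (-x / (κ * v)) * gauss τ v)) +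
        ∫ v in Ioi (0 : ℝ), v ^ 2 * gain κ S x v :=
  h.integral_mul_half (φ := fun v => v ^ 2) hκ hx (by fun_prop) (integrableOn_sq_mul_gauss hτ)
    (integrableOn_sq_mul_gauss hσ)

/-- The flux through the wall `x = 1`. -/
lemma integral_id_mul_half_one (h : IsSource b σ S) (hκ : 0 < κ) (hτ : 0 < τ) (hσ : 0 < σ) :
    ∫ v in Ioi (0 : ℝ), v * half κ τ A S 1 v = A * Cwall κ τ + outflow κ S := by
  rw [h.integral_mul_half (φ := fun v => v) hκ zero_le_one measurable_id'
    (integrableOn_mul_gauss hτ) (integrableOn_mul_gauss hσ), h.integral_mul_gain_one hκ hσ, Cwall_eq,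
    mul_assoc]

/-- Balance of mass: the flux changes by the difference between emitted and absorbed particles. -/
lemma flux_balance (h : IsSource b σ S) (hκ : 0 < κ) (hτ : 0 < τ) (hσ : 0 < σ) {x : ℝ}
    (hx : 0 ≤ x) :
    κ * ((∫ v in Ioi (0 : ℝ), v * half κ τ A S x v) - A) =
      ∫ y in (0 : ℝ)..x, ((∫ v in Ioi (0 : ℝ), S y v) - ∫ v in Ioi (0 : ℝ), half κ τ A S y v) := by
  have h1 : ∫ y in (0 : ℝ)..x,
        ((∫ v in Ioi (0 : ℝ), S y v) - ∫ v in Ioi (0 : ℝ), half κ τ A S y v) =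
      ∫ y in (0 : ℝ)..x, ∫ v in Ioi (0 : ℝ), (S y v - half κ τ A S y v) := by
    refine intervalIntegral.integral_congr fun y hy => ?_
    rw [uIcc_of_le hx] at hy
    exact (integral_sub (h.integrableOn hσ y) (h.integrableOn_half hκ hτ hσ hy.1)).symm
  have hQ : IntegrableOn (fun v => b * gauss σ v + (|A| * wallMxw τ v + b * gauss σ v)) (Ioi 0) := by
    refine ((integrableOn_gauss hσ).const_mul b).add ?_
    simpa [IntegrableOn] using integrableOn_envelope (φ := fun _ => 1) (A := A) (b := b)
      (by simpa using integrableOn_gauss hτ) (by simpa using integrableOn_gauss hσ)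
  have hw : ∫ v in Ioi (0 : ℝ), v * wallMxw τ v = 1 := by
    simp_rw [wallMxw_eq, mul_left_comm _ τ⁻¹, integral_const_mul, integral_mul_gauss hτ]
    field_simp
  have hwi : IntegrableOn (fun v => v * wallMxw τ v) (Ioi 0) := by
    simp_rw [wallMxw_eq, mul_left_comm _ τ⁻¹]
    exact (integrableOn_mul_gauss hτ).const_mul _
  have hm : Measurable (Function.uncurry fun y v => S y v - half κ τ A S y v) :=
    h.cont.measurable.sub (measurable_half h.cont.measurable)
  rw [h1, integral_swap_of_bound hx hm hQ fun y hy v hv => (abs_sub _ _).trans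
      (add_le_add (h.bound y v) (h.abs_half_le hκ hτ hy.1.le hv))]
  have h2 : (∫ v in Ioi (0 : ℝ), v * half κ τ A S x v) - A =
      ∫ v in Ioi (0 : ℝ), (v * half κ τ A S x v - A * (v * wallMxw τ v)) := by
    rw [integral_sub (h.integrableOn_id_mul_half hκ hτ hσ hx) (hwi.const_mul A),
      integral_const_mul, hw, mul_one]
  rw [h2, ← integral_const_mul]
  refine setIntegral_congr_fun measurableSet_Ioi fun v hv => ?_
  have hv' : (0 : ℝ) < v := hv
  have hc : Continuous fun y => S y v - half κ τ A S y v :=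
    (h.continuous_left v).sub (continuous_half (h.continuous_left v))
  have h3 := intervalIntegral.integral_eq_sub_of_hasDerivAt (a := 0) (b := x)
    (fun y _ => hasDerivAt_half (κ := κ) (τ := τ) (A := A) (h.continuous_left v) y)
    (hc.const_mul _ |>.intervalIntegrable _ _)
  rw [intervalIntegral.integral_const_mul, half_zero] at h3
  have h4 : ∫ y in (0 : ℝ)..x, (S y v - half κ τ A S y v) =
      (κ * v) * (half κ τ A S x v - A * wallMxw τ v) := by
    rw [← h3]
    field_simp
  simp only [h4]
  ring

end IsSource

/-- The reflection of a source about the midpoint of the slab. -/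
def reflect (S : ℝ → ℝ → ℝ) : ℝ → ℝ → ℝ := fun y v => S (1 - y) v

lemma reflect_reflect (S : ℝ → ℝ → ℝ) : reflect (reflect S) = S := by
  ext y v
  simp [reflect]

lemma IsSource.reflected {b σ : ℝ} {S : ℝ → ℝ → ℝ} (h : IsSource b σ S) :
    IsSource b σ (reflect S) :=
  ⟨h.cont.comp (by fun_prop : Continuous fun p : ℝ × ℝ => (1 - p.1, p.2)), fun _ _ => h.bound _ _⟩

/-- The flux emitted by the wall `x = 0` (at temperature `T₁`) in the stationary state with
source `S`, the wall `x = 1` being at temperature `T₂`. -/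
noncomputable def amp (κ T₁ T₂ : ℝ) (S : ℝ → ℝ → ℝ) : ℝ :=
  (outflow κ (reflect S) + Cwall κ T₂ * outflow κ S) / (1 - Cwall κ T₁ * Cwall κ T₂)

/-- The stationary distribution of the particles moving away from the wall `x = 0`. -/
noncomputable def wave (κ T₁ T₂ : ℝ) (S : ℝ → ℝ → ℝ) (x v : ℝ) : ℝ :=
  half κ T₁ (amp κ T₁ T₂ S) S x v

/-- The flux scale of the free molecular limit, inverted. -/
noncomputable def fluxScale (T₁ T₂ : ℝ) : ℝ := √(π / 2) * ((√T₁)⁻¹ + (√T₂)⁻¹)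

/-- The nearly free molecular regime, with all errors of relative size `η`. -/
structure Regime (κ T₁ T₂ η : ℝ) : Prop where
  κ_pos : 0 < κ
  left_pos : 0 < T₁
  right_pos : 0 < T₂
  η_nonneg : 0 ≤ η
  η_le : η ≤ 1 / 4000
  left_zero : ∫ v in Ioi (0 : ℝ), √((κ * v)⁻¹) * gauss T₁ v ≤ η * √T₁
  right_zero : ∫ v in Ioi (0 : ℝ), √((κ * v)⁻¹) * gauss T₂ v ≤ η * √T₂
  left_two : ∫ v in Ioi (0 : ℝ), √((κ * v)⁻¹) * (v ^ 2 * gauss T₁ v) ≤ η * (T₁ * √T₁)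
  right_two : ∫ v in Ioi (0 : ℝ), √((κ * v)⁻¹) * (v ^ 2 * gauss T₂ v) ≤ η * (T₂ * √T₂)
  bulk_zero : ∫ v in Ioi (0 : ℝ), √((κ * v)⁻¹) * gauss (4 * √(T₁ * T₂)) v ≤ η * √(√(T₁ * T₂))
  bulk_two : ∫ v in Ioi (0 : ℝ), √((κ * v)⁻¹) * (v ^ 2 * gauss (4 * √(T₁ * T₂)) v) ≤
    η * (√(T₁ * T₂) * √(√(T₁ * T₂)))
  left_wall : 1 - Cwall κ T₁ ≤ η
  right_wall : 1 - Cwall κ T₂ ≤ η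

lemma one_le_sqrt_half_pi : 1 ≤ √(π / 2) := by
  rw [Real.one_le_sqrt]
  linarith [Real.pi_gt_three]

namespace Regime

variable {κ T₁ T₂ η B : ℝ} {S S' : ℝ → ℝ → ℝ}

lemma symm (h : Regime κ T₁ T₂ η) : Regime κ T₂ T₁ η where
  κ_pos := h.κ_pos
  left_pos := h.right_pos
  right_pos := h.left_pos
  η_nonneg := h.η_nonneg
  η_le := h.η_le
  left_zero := h.right_zero
  right_zero := h.left_zero
  left_two := h.right_two
  right_two := h.left_two
  bulk_zero := by rw [mul_comm T₂]; exact h.bulk_zero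
  bulk_two := by rw [mul_comm T₂]; exact h.bulk_two
  left_wall := h.right_wall
  right_wall := h.left_wall

lemma sqrt_left_pos (h : Regime κ T₁ T₂ η) : 0 < √T₁ := Real.sqrt_pos.2 h.left_pos

lemma sqrt_right_pos (h : Regime κ T₁ T₂ η) : 0 < √T₂ := Real.sqrt_pos.2 h.right_pos

lemma mean_pos (h : Regime κ T₁ T₂ η) : 0 < √(T₁ * T₂) :=
  Real.sqrt_pos.2 (mul_pos h.left_pos h.right_pos)

lemma fluxScale_pos (h : Regime κ T₁ T₂ η) : 0 < fluxScale T₁ T₂ := by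
  have := h.sqrt_left_pos
  have := h.sqrt_right_pos
  have := one_le_sqrt_half_pi
  unfold fluxScale
  positivity

lemma le_density (h : Regime κ T₁ T₂ η) {x : ℝ} (hx : 0 ≤ x) (hx1 : x ≤ 1) :
    (√(π / 2) - η) * (√T₁)⁻¹ ≤
      T₁⁻¹ * ∫ v in Ioi (0 : ℝ), Real.exp (-x / (κ * v)) * gauss T₁ v := by
  have h1 := le_integral_mul_exp_mul_gauss (φ := fun _ => 1) (τ := T₁) h.κ_pos hx hx1
    measurable_const (fun _ _ => zero_le_one) (by simpa using integrableOn_gauss h.left_pos)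
    (by simpa using integrableOn_sqrt_mul_gauss h.κ_pos h.left_pos)
  simp only [one_mul, integral_gauss h.left_pos] at h1
  have h2 := h.left_zero
  have hs := h.sqrt_left_pos
  have e : (√T₁)⁻¹ = T₁⁻¹ * √T₁ := by
    have := Real.mul_self_sqrt h.left_pos.le
    have := h.left_pos
    field_simp
    nlinarith
  rw [e, mul_left_comm]
  have := inv_pos.2 h.left_pos
  gcongr
  linarith

lemma density_le (h : Regime κ T₁ T₂ η) {x : ℝ} (hx : 0 ≤ x) :
    T₁⁻¹ * ∫ v in Ioi (0 : ℝ), Real.exp (-x / (κ * v)) * gauss T₁ v ≤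
      √(π / 2) * (√T₁)⁻¹ := by
  have h1 := integral_mul_exp_mul_gauss_le (φ := fun _ => 1) (τ := T₁) h.κ_pos hx
    measurable_const (fun _ _ => zero_le_one) (by simpa using integrableOn_gauss h.left_pos)
  simp only [one_mul, integral_gauss h.left_pos] at h1
  have e : (√T₁)⁻¹ = T₁⁻¹ * √T₁ := by
    have := Real.mul_self_sqrt h.left_pos.le
    have := h.left_pos
    have hs := h.sqrt_left_pos
    field_simp
    nlinarith
  rw [e, mul_left_comm]
  have := inv_pos.2 h.left_pos
  gcongr

lemma le_pressure (h : Regime κ T₁ T₂ η) {x : ℝ} (hx : 0 ≤ x) (hx1 : x ≤ 1) :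
    (√(π / 2) - η) * √T₁ ≤
      T₁⁻¹ * ∫ v in Ioi (0 : ℝ), v ^ 2 * (Real.exp (-x / (κ * v)) * gauss T₁ v) := by
  have h1 := le_integral_mul_exp_mul_gauss (φ := fun v => v ^ 2) (τ := T₁) h.κ_pos hx hx1
    (by fun_prop) (fun _ _ => sq_nonneg _) (integrableOn_sq_mul_gauss h.left_pos)
    (integrableOn_sqrt_mul_sq_mul_gauss h.κ_pos h.left_pos)
  simp only [integral_sq_mul_gauss h.left_pos] at h1
  have h2 := h.left_two
  have hT := h.left_pos
  rw [← div_eq_inv_mul, le_div_iff₀ hT]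
  linarith

lemma pressure_le (h : Regime κ T₁ T₂ η) {x : ℝ} (hx : 0 ≤ x) :
    T₁⁻¹ * ∫ v in Ioi (0 : ℝ), v ^ 2 * (Real.exp (-x / (κ * v)) * gauss T₁ v) ≤
      √(π / 2) * √T₁ := by
  have h1 := integral_mul_exp_mul_gauss_le (φ := fun v => v ^ 2) (τ := T₁) h.κ_pos hx
    (by fun_prop) (fun _ _ => sq_nonneg _) (integrableOn_sq_mul_gauss h.left_pos)
  simp only [integral_sq_mul_gauss h.left_pos] at h1
  have hT := h.left_pos
  rw [← div_eq_inv_mul, div_le_iff₀ hT]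
  linarith

lemma le_wall (h : Regime κ T₁ T₂ η) : (√(π / 2) - η) * (√T₁)⁻¹ ≤ κ * (1 - Cwall κ T₁) :=
  (h.le_density zero_le_one le_rfl).trans (le_one_sub_Cwall h.κ_pos h.left_pos)

lemma wall_le (h : Regime κ T₁ T₂ η) : κ * (1 - Cwall κ T₁) ≤ √(π / 2) * (√T₁)⁻¹ := by
  refine (one_sub_Cwall_le h.κ_pos h.left_pos).trans_eq ?_
  have := Real.mul_self_sqrt h.left_pos.le
  have := h.left_pos
  have hs := h.sqrt_left_pos
  field_simp
  nlinarith

lemma Cwall_lt_one (h : Regime κ T₁ T₂ η) : Cwall κ T₁ < 1 := by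
  have h1 := h.le_wall
  have h2 := one_le_sqrt_half_pi
  have h3 := h.η_le
  have h4 : 0 < (√(π / 2) - η) * (√T₁)⁻¹ :=
    mul_pos (by linarith) (inv_pos.2 h.sqrt_left_pos)
  nlinarith [h.κ_pos]

lemma le_den (h : Regime κ T₁ T₂ η) :
    (1 - 2 * η) * fluxScale T₁ T₂ ≤ κ * (1 - Cwall κ T₁ * Cwall κ T₂) := by
  have h1 := h.le_wall
  have h2 := h.symm.le_wall
  have h3 := h.symm.Cwall_lt_one
  have h4 := one_le_sqrt_half_pi
  have h5 := h.η_le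
  have h6 := h.η_nonneg
  have h7 := h.left_wall
  have p1 := inv_pos.2 h.sqrt_left_pos
  have p2 := inv_pos.2 h.sqrt_right_pos
  have hκ := h.κ_pos
  have e : κ * (1 - Cwall κ T₁ * Cwall κ T₂) = κ * (1 - Cwall κ T₁) +
      κ * (1 - Cwall κ T₂) * (1 - (1 - Cwall κ T₁)) := by ring
  have h8 : κ * (1 - Cwall κ T₂) * (1 - η) ≤
      κ * (1 - Cwall κ T₂) * (1 - (1 - Cwall κ T₁)) := by
    have : 0 ≤ κ * (1 - Cwall κ T₂) := mul_nonneg hκ.le (by linarith)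
    gcongr
  have h9 : (1 - 2 * η) * √(π / 2) ≤ √(π / 2) - η := by nlinarith
  have h10 : (1 - 2 * η) * √(π / 2) ≤ (√(π / 2) - η) * (1 - η) := by nlinarith
  rw [e]
  calc (1 - 2 * η) * fluxScale T₁ T₂
      = (1 - 2 * η) * √(π / 2) * (√T₁)⁻¹ + (1 - 2 * η) * √(π / 2) * (√T₂)⁻¹ := by
        unfold fluxScale; ring
    _ ≤ (√(π / 2) - η) * (√T₁)⁻¹ + (√(π / 2) - η) * (1 - η) * (√T₂)⁻¹ := by gcongr
    _ ≤ κ * (1 - Cwall κ T₁) + κ * (1 - Cwall κ T₂) * (1 - η) := by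
        have : 0 ≤ 1 - η := by linarith
        rw [mul_right_comm]
        gcongr
    _ ≤ _ := by linarith

lemma den_le (h : Regime κ T₁ T₂ η) :
    κ * (1 - Cwall κ T₁ * Cwall κ T₂) ≤ fluxScale T₁ T₂ := by
  have h1 := h.wall_le
  have h2 := h.symm.wall_le
  have h3 := h.symm.Cwall_lt_one
  have h4 := h.Cwall_lt_one
  have hκ := h.κ_pos
  have e : κ * (1 - Cwall κ T₁ * Cwall κ T₂) = κ * (1 - Cwall κ T₁) +
      κ * (1 - Cwall κ T₂) - κ * ((1 - Cwall κ T₁) * (1 - Cwall κ T₂)) := by ring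
  have h5 : 0 ≤ κ * ((1 - Cwall κ T₁) * (1 - Cwall κ T₂)) :=
    mul_nonneg hκ.le (mul_nonneg (by linarith) (by linarith))
  rw [e]
  unfold fluxScale
  linarith

lemma den_pos (h : Regime κ T₁ T₂ η) : 0 < 1 - Cwall κ T₁ * Cwall κ T₂ := by
  have h1 := h.le_den
  have h2 : 0 < (1 - 2 * η) * fluxScale T₁ T₂ :=
    mul_pos (by linarith [h.η_le]) h.fluxScale_pos
  exact pos_of_mul_pos_right (h2.trans_le h1) h.κ_pos.le

end Regime

/-- A source at the scale of the regime, with relative size `B`. -/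
abbrev IsScaledSource (T₁ T₂ B : ℝ) (S : ℝ → ℝ → ℝ) : Prop :=
  IsSource (B / √(√(T₁ * T₂))) (4 * √(T₁ * T₂)) S

namespace Regime

variable {κ T₁ T₂ η B : ℝ} {S S' : ℝ → ℝ → ℝ}

lemma bulk_pos (h : Regime κ T₁ T₂ η) : 0 < 4 * √(T₁ * T₂) := by
  have := h.mean_pos
  positivity

lemma abs_outflow_le (h : Regime κ T₁ T₂ η) (hS : IsScaledSource T₁ T₂ B S) :
    |κ * outflow κ S - ∫ y in (0 : ℝ)..1, ∫ v in Ioi (0 : ℝ), S y v| ≤ B * η := by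
  refine (hS.abs_outflow_sub_le h.κ_pos h.bulk_pos).trans ?_
  have h1 := Real.sqrt_pos.2 h.mean_pos
  refine (mul_le_mul_of_nonneg_left h.bulk_zero hS.nonneg).trans_eq ?_
  field_simp

lemma abs_integral_gain_le (h : Regime κ T₁ T₂ η) (hS : IsScaledSource T₁ T₂ B S) {x : ℝ}
    (hx : 0 ≤ x) (hx1 : x ≤ 1) : |∫ v in Ioi (0 : ℝ), gain κ S x v| ≤ B * η := by
  have h0 := hS.abs_integral_mul_gain_le (φ := fun _ => 1) h.κ_pos hx hx1
    (fun _ _ => zero_le_one) (by simpa using integrableOn_sqrt_mul_gauss h.κ_pos h.bulk_pos)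
  simp only [one_mul] at h0
  refine h0.trans ?_
  have h1 := Real.sqrt_pos.2 h.mean_pos
  refine (mul_le_mul_of_nonneg_left h.bulk_zero hS.nonneg).trans_eq ?_
  field_simp

lemma abs_integral_sq_mul_gain_le (h : Regime κ T₁ T₂ η) (hS : IsScaledSource T₁ T₂ B S) {x : ℝ}
    (hx : 0 ≤ x) (hx1 : x ≤ 1) :
    |∫ v in Ioi (0 : ℝ), v ^ 2 * gain κ S x v| ≤ B * η * √(T₁ * T₂) := by
  have h0 := hS.abs_integral_mul_gain_le (φ := fun v => v ^ 2) h.κ_pos hx hx1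
    (fun _ _ => sq_nonneg _) (integrableOn_sqrt_mul_sq_mul_gauss h.κ_pos h.bulk_pos)
  refine h0.trans ?_
  have h1 := Real.sqrt_pos.2 h.mean_pos
  refine (mul_le_mul_of_nonneg_left h.bulk_two hS.nonneg).trans_eq ?_
  field_simp

end Regime

lemma integral_reflect (S : ℝ → ℝ → ℝ) :
    ∫ y in (0 : ℝ)..1, ∫ v in Ioi (0 : ℝ), reflect S y v =
      ∫ y in (0 : ℝ)..1, ∫ v in Ioi (0 : ℝ), S y v := by
  have := intervalIntegral.integral_comp_sub_left (a := 0) (b := 1)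
    (fun y => ∫ v in Ioi (0 : ℝ), S y v) 1
  simpa [reflect] using this

/-- The share of the density carried by the particles leaving the wall `x = 0`. -/
noncomputable def share (T₁ T₂ : ℝ) : ℝ := √T₂ / (√T₁ + √T₂)

namespace Regime

variable {κ T₁ T₂ η B d : ℝ} {S S' : ℝ → ℝ → ℝ}

lemma amp_eq (h : Regime κ T₁ T₂ η) :
    amp κ T₁ T₂ S = (κ * outflow κ (reflect S) + Cwall κ T₂ * (κ * outflow κ S)) /
      (κ * (1 - Cwall κ T₁ * Cwall κ T₂)) := by
  have h1 := h.den_pos.ne'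
  have h2 := h.κ_pos.ne'
  unfold amp
  field_simp

lemma abs_reflect_outflow_le (h : Regime κ T₁ T₂ η) (hS : IsScaledSource T₁ T₂ B S) :
    |κ * outflow κ (reflect S) - ∫ y in (0 : ℝ)..1, ∫ v in Ioi (0 : ℝ), S y v| ≤ B * η := by
  rw [← integral_reflect S]
  exact h.abs_outflow_le (IsSource.reflected hS)

lemma abs_amp_sub_le (h : Regime κ T₁ T₂ η) (hS : IsScaledSource T₁ T₂ 2 S)
    (hm : ∫ y in (0 : ℝ)..1, ∫ v in Ioi (0 : ℝ), S y v = 1 / 2) :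
    |amp κ T₁ T₂ S * fluxScale T₁ T₂ - 1| ≤ 8 * η := by
  have h1 := abs_le.1 (h.abs_outflow_le hS)
  have h2 := abs_le.1 (h.abs_reflect_outflow_le hS)
  rw [hm] at h1 h2
  have h3 := h.le_den
  have h4 := h.den_le
  have h5 := h.η_nonneg
  have h6 := h.η_le
  have h7 := h.right_wall
  have h8 := h.symm.Cwall_lt_one
  have hF := h.fluxScale_pos
  rw [h.amp_eq]
  set D := κ * (1 - Cwall κ T₁ * Cwall κ T₂)
  have hD : 0 < D := mul_pos h.κ_pos h.den_pos
  set a := κ * outflow κ (reflect S)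
  set b := κ * outflow κ S
  set C := Cwall κ T₂
  have h9 : 0 ≤ (1 - C) * b := mul_nonneg (by linarith) (by linarith)
  have h10 : (1 - C) * b ≤ η * 1 := by
    apply mul_le_mul h7 (by linarith) (by linarith) h5
  have h11 : 1 - 5 * η ≤ a + C * b := by linarith
  have h12 : a + C * b ≤ 1 + 5 * η := by linarith
  rw [abs_le, div_mul_eq_mul_div]
  constructor
  · rw [le_sub_iff_add_le, le_div_iff₀ hD]
    calc (-(8 * η) + 1) * D ≤ (-(8 * η) + 1) * fluxScale T₁ T₂ := by gcongr; linarith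
      _ ≤ _ := mul_le_mul_of_nonneg_right (by linarith) hF.le
  · rw [sub_le_iff_le_add, div_le_iff₀ hD]
    calc (a + C * b) * fluxScale T₁ T₂ ≤ ((8 * η + 1) * (1 - 2 * η)) * fluxScale T₁ T₂ := by
          gcongr; nlinarith
      _ = (8 * η + 1) * ((1 - 2 * η) * fluxScale T₁ T₂) := by ring
      _ ≤ _ := by gcongr

lemma amp_pos (h : Regime κ T₁ T₂ η) (hS : IsScaledSource T₁ T₂ 2 S)
    (hm : ∫ y in (0 : ℝ)..1, ∫ v in Ioi (0 : ℝ), S y v = 1 / 2) : 0 < amp κ T₁ T₂ S := by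
  have h1 := (abs_le.1 (h.abs_amp_sub_le hS hm)).1
  have h2 := h.η_le
  have hF := h.fluxScale_pos
  refine pos_of_mul_pos_left (b := fluxScale T₁ T₂) (by linarith) hF.le

lemma amp_sub (h : Regime κ T₁ T₂ η) (hS : IsScaledSource T₁ T₂ B S)
    (hS' : IsScaledSource T₁ T₂ B S') :
    amp κ T₁ T₂ (fun y v => S y v - S' y v) = amp κ T₁ T₂ S - amp κ T₁ T₂ S' := by
  have h1 := IsSource.outflow_sub hS hS' h.κ_pos h.bulk_pos h.bulk_pos
  have h2 := IsSource.outflow_sub (IsSource.reflected hS) (IsSource.reflected hS') h.κ_pos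
    h.bulk_pos h.bulk_pos
  have h3 : reflect (fun y v => S y v - S' y v) = fun y v => reflect S y v - reflect S' y v := rfl
  unfold amp
  rw [h3, h1, h2]
  ring

/-- A source without net mass is re-emitted at the order of the error of the regime. -/
lemma abs_amp_le (h : Regime κ T₁ T₂ η) (hS : IsScaledSource T₁ T₂ B S)
    (hm : ∫ y in (0 : ℝ)..1, ∫ v in Ioi (0 : ℝ), S y v = 0) :
    |amp κ T₁ T₂ S| * fluxScale T₁ T₂ ≤ 3 * B * η := by
  have h1 := h.abs_outflow_le hS
  have h2 := h.abs_reflect_outflow_le hS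
  rw [hm, sub_zero] at h1 h2
  have h3 := h.le_den
  have h5 := h.η_nonneg
  have h6 := h.η_le
  have h7 := h.right_wall
  have h8 := h.symm.Cwall_lt_one
  have hF := h.fluxScale_pos
  have hBη : 0 ≤ B * η := (abs_nonneg _).trans h1
  rw [h.amp_eq, abs_div]
  set D := κ * (1 - Cwall κ T₁ * Cwall κ T₂)
  have hD : 0 < D := mul_pos h.κ_pos h.den_pos
  set a := κ * outflow κ (reflect S)
  set b := κ * outflow κ S
  set C := Cwall κ T₂
  have h9 : |C * b| ≤ 1 * (B * η) := by
    rw [abs_mul]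
    gcongr
    rw [abs_le]
    constructor <;> linarith
  have h10 : |a + C * b| ≤ 2 * (B * η) := (abs_add_le _ _).trans (by linarith)
  rw [abs_of_pos hD, div_mul_eq_mul_div, div_le_iff₀ hD]
  calc |a + C * b| * fluxScale T₁ T₂ ≤ 2 * (B * η) * fluxScale T₁ T₂ := by gcongr
    _ ≤ 3 * (B * η) * (1 - 2 * η) * fluxScale T₁ T₂ :=
        mul_le_mul_of_nonneg_right (by nlinarith) hF.le
    _ = 3 * B * η * ((1 - 2 * η) * fluxScale T₁ T₂) := by ring
    _ ≤ _ := mul_le_mul_of_nonneg_left h3 (by linarith)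

lemma share_add_share (h : Regime κ T₁ T₂ η) : share T₁ T₂ + share T₂ T₁ = 1 := by
  have h1 := h.sqrt_left_pos
  have h2 := h.sqrt_right_pos
  unfold share
  rw [add_comm (√T₂) (√T₁), ← add_div, add_comm (√T₂)]
  exact div_self (by positivity)

lemma share_pos (h : Regime κ T₁ T₂ η) : 0 < share T₁ T₂ := by
  have h1 := h.sqrt_left_pos
  have h2 := h.sqrt_right_pos
  unfold share
  positivity

lemma fluxScale_mul_share (h : Regime κ T₁ T₂ η) :
    fluxScale T₁ T₂ * share T₁ T₂ = √(π / 2) * (√T₁)⁻¹ := by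
  have h1 := h.sqrt_left_pos
  have h2 := h.sqrt_right_pos
  unfold fluxScale share
  field_simp
  ring

lemma fluxScale_mul_share' (h : Regime κ T₁ T₂ η) :
    fluxScale T₁ T₂ * (share T₂ T₁ * √(T₁ * T₂)) = √(π / 2) * √T₁ := by
  have h1 := h.sqrt_left_pos
  have h2 := h.sqrt_right_pos
  rw [Real.sqrt_mul h.left_pos.le]
  unfold fluxScale share
  field_simp

/-- Product of the amplitude and of a moment of the attenuated wall Maxwellian. -/
lemma abs_mul_sub_le {A F w m q η J : ℝ} (hη : 0 ≤ η) (hη1 : η ≤ 1 / 4000) (hF : 0 < F) (hw : 0 < w)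
    (hA : |A * F - 1| ≤ 8 * η) (hq : 1 ≤ q) (hFw : F * w = q * m)
    (hm : 0 < m) (hJ : (q - η) * m ≤ J) (hJ' : J ≤ q * m) :
    |A * J - w| ≤ 10 * η * w := by
  have h1 := abs_le.1 hA
  have hA0 : 0 < A := pos_of_mul_pos_left (b := F) (by linarith) hF.le
  have e : A * (q * m) = (A * F) * w := by rw [← hFw]; ring
  have hηm : 0 ≤ η * m := mul_nonneg hη hm.le
  have hl : (1 - η) * (q * m) ≤ J := by nlinarith
  have h2 := mul_le_mul_of_nonneg_left hl hA0.le
  have h3 := mul_le_mul_of_nonneg_left hJ' hA0.le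
  have h4 : A * ((1 - η) * (q * m)) = (1 - η) * ((A * F) * w) := by rw [← e]; ring
  have h5 : (1 - η) * (1 - 8 * η) * w ≤ (1 - η) * ((A * F) * w) := by
    rw [mul_assoc]
    gcongr <;> linarith
  have h6 : (A * F) * w ≤ (1 + 8 * η) * w := by gcongr; linarith
  rw [abs_le]
  constructor <;> nlinarith [mul_nonneg hη hw.le, mul_nonneg (mul_nonneg hη hη) hw.le]

lemma abs_integral_wave_sub_le (h : Regime κ T₁ T₂ η) (hS : IsScaledSource T₁ T₂ 2 S)
    (hm : ∫ y in (0 : ℝ)..1, ∫ v in Ioi (0 : ℝ), S y v = 1 / 2) {x : ℝ} (hx : 0 ≤ x)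
    (hx1 : x ≤ 1) :
    |(∫ v in Ioi (0 : ℝ), wave κ T₁ T₂ S x v) - share T₁ T₂| ≤ 10 * η * share T₁ T₂ + 2 * η := by
  have h1 := h.abs_integral_gain_le hS hx hx1
  have h2 := IsSource.integral_half (A := amp κ T₁ T₂ S) hS h.κ_pos h.left_pos h.bulk_pos hx
  have h3 := abs_mul_sub_le h.η_nonneg h.η_le h.fluxScale_pos h.share_pos
    (h.abs_amp_sub_le hS hm) one_le_sqrt_half_pi h.fluxScale_mul_share
    (inv_pos.2 h.sqrt_left_pos) (h.le_density hx hx1) (h.density_le hx)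
  unfold wave
  rw [h2, mul_assoc, add_sub_right_comm]
  exact (abs_add_le _ _).trans (add_le_add h3 h1)

lemma abs_integral_sq_mul_wave_sub_le (h : Regime κ T₁ T₂ η) (hS : IsScaledSource T₁ T₂ 2 S)
    (hm : ∫ y in (0 : ℝ)..1, ∫ v in Ioi (0 : ℝ), S y v = 1 / 2) {x : ℝ} (hx : 0 ≤ x)
    (hx1 : x ≤ 1) :
    |(∫ v in Ioi (0 : ℝ), v ^ 2 * wave κ T₁ T₂ S x v) - share T₂ T₁ * √(T₁ * T₂)| ≤
      (10 * η * share T₂ T₁ + 2 * η) * √(T₁ * T₂) := by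
  have h1 := h.abs_integral_sq_mul_gain_le hS hx hx1
  have h2 := IsSource.integral_sq_mul_half (A := amp κ T₁ T₂ S) hS h.κ_pos h.left_pos h.bulk_pos hx
  have h3 := abs_mul_sub_le h.η_nonneg h.η_le h.fluxScale_pos
    (mul_pos h.symm.share_pos h.mean_pos)
    (h.abs_amp_sub_le hS hm) one_le_sqrt_half_pi h.fluxScale_mul_share'
    h.sqrt_left_pos (h.le_pressure hx hx1) (h.pressure_le hx)
  unfold wave
  rw [h2, mul_assoc, add_sub_right_comm]
  refine (abs_add_le _ _).trans ((add_le_add h3 h1).trans_eq ?_)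
  ring

lemma wave_sub (h : Regime κ T₁ T₂ η) (hS : IsScaledSource T₁ T₂ B S)
    (hS' : IsScaledSource T₁ T₂ B S') (x v : ℝ) :
    wave κ T₁ T₂ (fun y v => S y v - S' y v) x v =
      wave κ T₁ T₂ S x v - wave κ T₁ T₂ S' x v := by
  unfold wave half
  rw [h.amp_sub hS hS', gain_sub (hS.continuous_left v) (hS'.continuous_left v)]
  ring

/-- Product of a small amplitude and of a moment of the attenuated wall Maxwellian. -/
lemma abs_mul_le {A F w m q J E : ℝ} (hE : |A| * F ≤ E) (hFw : F * w = q * m) (hw : 0 < w)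
    (hw1 : w ≤ 1) (hF : 0 < F) (hJ : 0 ≤ J) (hJ' : J ≤ q * m) : |A * J| ≤ E := by
  rw [abs_mul, abs_of_nonneg hJ]
  calc |A| * J ≤ |A| * (q * m) := by gcongr
    _ = |A| * F * w := by rw [← hFw]; ring
    _ ≤ E * 1 := by
      have : 0 ≤ E := le_trans (by positivity) hE
      gcongr
    _ = E := mul_one _

lemma share_le_one (h : Regime κ T₁ T₂ η) : share T₁ T₂ ≤ 1 := by
  linarith [h.share_add_share, h.symm.share_pos]

lemma abs_integral_wave_le (h : Regime κ T₁ T₂ η) (hS : IsScaledSource T₁ T₂ B S)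
    (hm : ∫ y in (0 : ℝ)..1, ∫ v in Ioi (0 : ℝ), S y v = 0) {x : ℝ} (hx : 0 ≤ x)
    (hx1 : x ≤ 1) : |∫ v in Ioi (0 : ℝ), wave κ T₁ T₂ S x v| ≤ 4 * B * η := by
  have h1 := h.abs_integral_gain_le hS hx hx1
  have h2 := IsSource.integral_half (A := amp κ T₁ T₂ S) hS h.κ_pos h.left_pos h.bulk_pos hx
  have h0 : 0 ≤ (√(π / 2) - η) * (√T₁)⁻¹ :=
    mul_nonneg (by linarith [one_le_sqrt_half_pi, h.η_le]) (inv_pos.2 h.sqrt_left_pos).le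
  have h3 := abs_mul_le (h.abs_amp_le hS hm) h.fluxScale_mul_share h.share_pos h.share_le_one
    h.fluxScale_pos (h0.trans (h.le_density hx hx1)) (h.density_le hx)
  unfold wave
  rw [h2, mul_assoc]
  refine (abs_add_le _ _).trans ((add_le_add h3 h1).trans_eq ?_)
  ring

lemma abs_integral_sq_mul_wave_le (h : Regime κ T₁ T₂ η) (hS : IsScaledSource T₁ T₂ B S)
    (hm : ∫ y in (0 : ℝ)..1, ∫ v in Ioi (0 : ℝ), S y v = 0) {x : ℝ} (hx : 0 ≤ x)
    (hx1 : x ≤ 1) :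
    |∫ v in Ioi (0 : ℝ), v ^ 2 * wave κ T₁ T₂ S x v| ≤ 4 * B * η * √(T₁ * T₂) := by
  have h1 := h.abs_integral_sq_mul_gain_le hS hx hx1
  have h2 := IsSource.integral_sq_mul_half (A := amp κ T₁ T₂ S) hS h.κ_pos h.left_pos h.bulk_pos hx
  have ht := h.mean_pos
  have h0 : 0 ≤ (√(π / 2) - η) * √T₁ :=
    mul_nonneg (by linarith [one_le_sqrt_half_pi, h.η_le]) h.sqrt_left_pos.le
  have hFw : fluxScale T₁ T₂ * share T₂ T₁ = √(π / 2) * (√T₁ / √(T₁ * T₂)) := by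
    rw [← mul_div_assoc, ← h.fluxScale_mul_share']
    field_simp
  have h3 := abs_mul_le (h.abs_amp_le hS hm) hFw h.symm.share_pos h.symm.share_le_one
    h.fluxScale_pos (div_nonneg (h0.trans (h.le_pressure hx hx1)) ht.le)
    (by rw [← mul_div_assoc]; exact div_le_div_of_nonneg_right (h.pressure_le hx) ht.le)
  rw [← mul_div_assoc, abs_div, abs_of_pos ht, div_le_iff₀ ht] at h3
  unfold wave
  rw [h2, mul_assoc]
  refine (abs_add_le _ _).trans ((add_le_add h3 h1).trans_eq ?_)
  ring

end Regime

lemma Mxw_eq (τ v : ℝ) :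
    Mxw τ v = (2 * √(π / 2) * √τ)⁻¹ * gauss τ v := by
  have : √(2 * π * τ) = 2 * √(π / 2) * √τ := by
    rw [show 2 * π * τ = 2 ^ 2 * (π / 2) * τ by ring, Real.sqrt_mul (by positivity),
      Real.sqrt_mul (by positivity), Real.sqrt_sq (by norm_num)]
  rw [Mxw, this, gauss]

lemma Mxw_nonneg (τ v : ℝ) : 0 ≤ Mxw τ v := by
  unfold Mxw
  positivity

lemma Mxw_neg (τ v : ℝ) : Mxw τ (-v) = Mxw τ v := by
  unfold Mxw
  rw [neg_sq]

lemma integral_Mxw {τ : ℝ} (hτ : 0 < τ) : ∫ v in Ioi (0 : ℝ), Mxw τ v = 1 / 2 := by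
  have h1 := Real.sqrt_pos.2 hτ
  have h2 : 0 < √(π / 2) := by positivity
  simp_rw [Mxw_eq]
  rw [integral_const_mul, integral_gauss hτ]
  field_simp

lemma gauss_le_gauss {τ τ' : ℝ} (hτ : 0 < τ) (h : τ ≤ τ') (v : ℝ) : gauss τ v ≤ gauss τ' v := by
  unfold gauss
  rw [Real.exp_le_exp, neg_div, neg_div, neg_le_neg_iff]
  gcongr

lemma Mxw_le {t a : ℝ} (ht : 0 < t) (ha : 1 / 2 ≤ a) (ha2 : a ≤ 2) (v : ℝ) :
    Mxw (t * a) v ≤ (√t)⁻¹ * gauss (2 * t) v := by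
  have hta : 0 < t * a := by positivity
  rw [Mxw_eq]
  have h1 : gauss (t * a) v ≤ gauss (2 * t) v := gauss_le_gauss hta (by nlinarith) v
  have h2 := one_le_sqrt_half_pi
  have h3 := Real.sqrt_pos.2 ht
  have h4 : √t ≤ 2 * √(t * a) := by
    rw [Real.sqrt_le_left (by positivity), mul_pow, Real.sq_sqrt hta.le]
    nlinarith
  have h5 : √t ≤ 2 * √(π / 2) * √(t * a) := by nlinarith [Real.sqrt_nonneg (t * a)]
  have := gauss_pos (t * a) v
  gcongr

lemma hasDerivAt_Mxw {t a : ℝ} (ht : 0 < t) (ha : 0 < a) (v : ℝ) :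
    HasDerivAt (fun a => Mxw (t * a) v)
      (Mxw (t * a) v * (v ^ 2 / (2 * t * a ^ 2) - 1 / (2 * a))) a := by
  have h1 : HasDerivAt (fun a => 2 * π * (t * a)) (2 * π * t) a := by
    simpa [mul_assoc] using ((hasDerivAt_id a).const_mul t).const_mul (2 * π)
  have hp : 0 < 2 * π * (t * a) := by positivity
  have h2 := (h1.sqrt hp.ne').fun_inv (Real.sqrt_pos.2 hp).ne'
  have h3 : HasDerivAt (fun a => -v ^ 2 / (2 * (t * a))) (v ^ 2 / (2 * t * a ^ 2)) a := by
    have h4 : HasDerivAt (fun a => 2 * (t * a)) (2 * t) a := by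
      simpa [mul_assoc] using ((hasDerivAt_id a).const_mul t).const_mul 2
    refine ((hasDerivAt_const a (-v ^ 2)).fun_div h4 (by positivity)).congr_deriv ?_
    field_simp
    ring
  refine (h2.fun_mul h3.exp).congr_deriv ?_
  have hs := Real.sqrt_pos.2 hp
  have hq := Real.sq_sqrt hp.le
  unfold Mxw
  rw [hq]
  field_simp
  ring

lemma abs_Mxw_sub_le {t a a' : ℝ} (ht : 0 < t) (ha : a ∈ Icc (1 / 2 : ℝ) 2)
    (ha' : a' ∈ Icc (1 / 2 : ℝ) 2) (v : ℝ) :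
    |Mxw (t * a) v - Mxw (t * a') v| ≤ 17 * ((√t)⁻¹ * gauss (4 * t) v) * |a - a'| := by
  refine (convex_Icc (1 / 2 : ℝ) 2).norm_image_sub_le_of_norm_hasDerivWithin_le
    (f := fun a => Mxw (t * a) v)
    (fun b hb => (hasDerivAt_Mxw ht (by linarith [hb.1]) v).hasDerivWithinAt) (fun b hb => ?_)
    ha' ha
  have hb0 : 0 < b := by linarith [hb.1]
  have hb1 := hb.1
  have h1 := Mxw_le ht hb.1 hb.2 v
  have h2 := sq_mul_gauss_le (τ := 2 * t) (by positivity) v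
  rw [show 2 * (2 * t) = 4 * t by ring] at h2
  have h3 := gauss_le_gauss (by positivity : 0 < 2 * t) (by linarith : 2 * t ≤ 4 * t) v
  have hs := Real.sqrt_pos.2 ht
  rw [Real.norm_eq_abs, abs_mul, abs_of_nonneg (Mxw_nonneg _ _)]
  have h4 : |v ^ 2 / (2 * t * b ^ 2) - 1 / (2 * b)| ≤ 2 * v ^ 2 / t + 1 := by
    refine (abs_sub _ _).trans ?_
    rw [abs_of_nonneg (by positivity), abs_of_nonneg (by positivity)]
    gcongr ?_ + ?_
    · rw [div_le_div_iff₀ (by positivity) ht]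
      have : 1 ≤ 4 * b ^ 2 := by nlinarith
      nlinarith [mul_nonneg (sq_nonneg v) ht.le]
    · rw [div_le_one (by positivity)]
      linarith
  calc Mxw (t * b) v * |v ^ 2 / (2 * t * b ^ 2) - 1 / (2 * b)|
      ≤ ((√t)⁻¹ * gauss (2 * t) v) * (2 * v ^ 2 / t + 1) := by
        gcongr
        exact (Mxw_nonneg _ _).trans h1
    _ = (√t)⁻¹ * (2 * (v ^ 2 * gauss (2 * t) v) / t + gauss (2 * t) v) := by ring
    _ ≤ (√t)⁻¹ * (2 * (4 * (2 * t) * gauss (4 * t) v) / t + gauss (4 * t) v) := by gcongr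
    _ = 17 * ((√t)⁻¹ * gauss (4 * t) v) := by field_simp; ring

/-- The Maxwellian source with density `r` and temperature `t * θ`. -/
noncomputable def maxwellSource (t : ℝ) (r θ : ℝ → ℝ) : ℝ → ℝ → ℝ :=
  fun y v => r y * Mxw (t * θ y) v

/-- Density and (normalized) temperature profiles close to one, of unit mass. -/
structure IsProfile (r θ : ℝ → ℝ) : Prop where
  continuous_density : Continuous r
  continuous_temp : Continuous θ
  density_mem : ∀ y, r y ∈ Icc (1 / 2 : ℝ) 2
  temp_mem : ∀ y, θ y ∈ Icc (1 / 2 : ℝ) 2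
  mass : ∫ y in (0 : ℝ)..1, r y = 1

namespace IsProfile

variable {r θ r' θ' : ℝ → ℝ} {t : ℝ}

lemma temp_pos (h : IsProfile r θ) (ht : 0 < t) (y : ℝ) : 0 < t * θ y :=
  mul_pos ht (by linarith [(h.temp_mem y).1])

lemma continuous_maxwellSource (h : IsProfile r θ) (ht : 0 < t) :
    Continuous (Function.uncurry (maxwellSource t r θ)) := by
  have h1 := h.continuous_density
  have h2 := h.continuous_temp
  have h3 : ∀ p : ℝ × ℝ, √(2 * π * (t * θ p.1)) ≠ 0 := fun p => by
    have := h.temp_pos ht p.1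
    positivity
  have h4 : ∀ p : ℝ × ℝ, 2 * (t * θ p.1) ≠ 0 := fun p => by
    have := h.temp_pos ht p.1
    positivity
  unfold maxwellSource Mxw Function.uncurry
  refine (h1.comp continuous_fst).mul (Continuous.mul ?_ ?_)
  · exact Continuous.inv₀ (by fun_prop) h3
  · exact Real.continuous_exp.comp (Continuous.div (by fun_prop) (by fun_prop) h4)

lemma maxwellSource_nonneg (h : IsProfile r θ) (y v : ℝ) : 0 ≤ maxwellSource t r θ y v :=
  mul_nonneg (by linarith [(h.density_mem y).1]) (Mxw_nonneg _ _)

lemma isSource (h : IsProfile r θ) (ht : 0 < t) :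
    IsSource (2 / √t) (4 * t) (maxwellSource t r θ) where
  cont := h.continuous_maxwellSource ht
  bound y v := by
    rw [abs_of_nonneg (h.maxwellSource_nonneg y v), div_eq_mul_inv, mul_assoc]
    have h1 := Mxw_le ht (h.temp_mem y).1 (h.temp_mem y).2 v
    have h3 := gauss_le_gauss (by positivity : 0 < 2 * t) (by linarith : 2 * t ≤ 4 * t) v
    have h4 := Real.sqrt_pos.2 ht
    refine mul_le_mul (h.density_mem y).2 (h1.trans ?_) (Mxw_nonneg _ _) (by norm_num)
    gcongr

lemma isSource_sub (h : IsProfile r θ) (h' : IsProfile r' θ') (ht : 0 < t) {d : ℝ}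
    (hr : ∀ y, |r y - r' y| ≤ d) (hθ : ∀ y, |θ y - θ' y| ≤ d) :
    IsSource (35 * d / √t) (4 * t)
      (fun y v => maxwellSource t r θ y v - maxwellSource t r' θ' y v) where
  cont := (h.continuous_maxwellSource ht).sub (h'.continuous_maxwellSource ht)
  bound y v := by
    have h1 := Mxw_le ht (h.temp_mem y).1 (h.temp_mem y).2 v
    have h2 := abs_Mxw_sub_le ht (h.temp_mem y) (h'.temp_mem y) v
    have h3 := gauss_le_gauss (by positivity : 0 < 2 * t) (by linarith : 2 * t ≤ 4 * t) v
    have h4 := Real.sqrt_pos.2 ht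
    have h5 := h'.density_mem y
    have h6 := hr y
    have h7 := hθ y
    have h8 := Mxw_nonneg (t * θ y) v
    have h9 := gauss_pos (4 * t) v
    have e : maxwellSource t r θ y v - maxwellSource t r' θ' y v =
        (r y - r' y) * Mxw (t * θ y) v + r' y * (Mxw (t * θ y) v - Mxw (t * θ' y) v) := by
      unfold maxwellSource; ring
    have h10 : |r' y| ≤ 2 := by rw [abs_le]; constructor <;> linarith [h5.1, h5.2]
    have hd : 0 ≤ d := (abs_nonneg _).trans h6
    rw [e]
    refine (abs_add_le _ _).trans ?_
    rw [abs_mul, abs_mul, abs_of_nonneg h8]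
    calc |r y - r' y| * Mxw (t * θ y) v + |r' y| * |Mxw (t * θ y) v - Mxw (t * θ' y) v|
        ≤ d * ((√t)⁻¹ * gauss (4 * t) v) + 2 * (17 * ((√t)⁻¹ * gauss (4 * t) v) * d) := by
          gcongr
          · refine h1.trans ?_
            gcongr
          · refine h2.trans ?_
            gcongr
      _ = 35 * d / √t * gauss (4 * t) v := by ring

lemma integral_maxwellSource (h : IsProfile r θ) (ht : 0 < t) (y : ℝ) :
    ∫ v in Ioi (0 : ℝ), maxwellSource t r θ y v = r y / 2 := by
  unfold maxwellSource
  rw [integral_const_mul, integral_Mxw (h.temp_pos ht y)]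
  ring

lemma mass_maxwellSource (h : IsProfile r θ) (ht : 0 < t) :
    ∫ y in (0 : ℝ)..1, ∫ v in Ioi (0 : ℝ), maxwellSource t r θ y v = 1 / 2 := by
  simp_rw [h.integral_maxwellSource ht]
  rw [intervalIntegral.integral_div, h.mass]

end IsProfile

/-- The density in the stationary state with source `S`. -/
noncomputable def density (κ T₁ T₂ : ℝ) (S : ℝ → ℝ → ℝ) (x : ℝ) : ℝ :=
  (∫ v in Ioi (0 : ℝ), wave κ T₁ T₂ S x v) +
    ∫ v in Ioi (0 : ℝ), wave κ T₂ T₁ (reflect S) (1 - x) v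

/-- The pressure in the stationary state with source `S`, at zero momentum. -/
noncomputable def pressure (κ T₁ T₂ : ℝ) (S : ℝ → ℝ → ℝ) (x : ℝ) : ℝ :=
  (∫ v in Ioi (0 : ℝ), v ^ 2 * wave κ T₁ T₂ S x v) +
    ∫ v in Ioi (0 : ℝ), v ^ 2 * wave κ T₂ T₁ (reflect S) (1 - x) v

lemma IsScaledSource.reflected {T₁ T₂ B : ℝ} {S : ℝ → ℝ → ℝ} (h : IsScaledSource T₁ T₂ B S) :
    IsScaledSource T₂ T₁ B (reflect S) := by
  unfold IsScaledSource
  rw [mul_comm T₂]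
  exact IsSource.reflected h

namespace Regime

variable {κ T₁ T₂ η B d : ℝ} {S S' : ℝ → ℝ → ℝ}

lemma amp_eq_add (h : Regime κ T₁ T₂ η) (S : ℝ → ℝ → ℝ) :
    amp κ T₁ T₂ S = outflow κ (reflect S) + Cwall κ T₂ * amp κ T₂ T₁ (reflect S) := by
  have h1 := h.den_pos.ne'
  unfold amp
  rw [reflect_reflect, mul_comm (Cwall κ T₂) (Cwall κ T₁), div_eq_iff h1, add_mul, mul_assoc,
    div_mul_cancel₀ _ h1]
  ring

lemma continuousOn_integral_wave (h : Regime κ T₁ T₂ η) (hS : IsScaledSource T₁ T₂ B S) :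
    ContinuousOn (fun x => ∫ v in Ioi (0 : ℝ), wave κ T₁ T₂ S x v) (Ici 0) :=
  IsSource.continuousOn_integral_half hS h.κ_pos h.left_pos h.bulk_pos

lemma continuousOn_integral_sq_mul_wave (h : Regime κ T₁ T₂ η) (hS : IsScaledSource T₁ T₂ B S) :
    ContinuousOn (fun x => ∫ v in Ioi (0 : ℝ), v ^ 2 * wave κ T₁ T₂ S x v) (Ici 0) :=
  IsSource.continuousOn_integral_sq_mul_half hS h.κ_pos h.left_pos h.bulk_pos

lemma integrableOn_wave (h : Regime κ T₁ T₂ η) (hS : IsScaledSource T₁ T₂ B S) {x : ℝ}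
    (hx : 0 ≤ x) : IntegrableOn (fun v => wave κ T₁ T₂ S x v) (Ioi 0) :=
  IsSource.integrableOn_half hS h.κ_pos h.left_pos h.bulk_pos hx

lemma integrableOn_id_mul_wave (h : Regime κ T₁ T₂ η) (hS : IsScaledSource T₁ T₂ B S) {x : ℝ}
    (hx : 0 ≤ x) : IntegrableOn (fun v => v * wave κ T₁ T₂ S x v) (Ioi 0) :=
  IsSource.integrableOn_id_mul_half hS h.κ_pos h.left_pos h.bulk_pos hx

lemma integrableOn_sq_mul_wave (h : Regime κ T₁ T₂ η) (hS : IsScaledSource T₁ T₂ B S) {x : ℝ}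
    (hx : 0 ≤ x) : IntegrableOn (fun v => v ^ 2 * wave κ T₁ T₂ S x v) (Ioi 0) :=
  IsSource.integrableOn_sq_mul_half hS h.κ_pos h.left_pos h.bulk_pos hx

lemma continuousOn_density (h : Regime κ T₁ T₂ η) (hS : IsScaledSource T₁ T₂ B S) :
    ContinuousOn (density κ T₁ T₂ S) (Icc 0 1) := by
  have h1 := (h.continuousOn_integral_wave hS).mono (Icc_subset_Ici_self : Icc (0 : ℝ) 1 ⊆ _)
  have h2 := (h.symm.continuousOn_integral_wave hS.reflected).comp
    (f := fun x : ℝ => 1 - x) (s := Icc 0 1) (by fun_prop) (fun x hx => by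
      simp only [mem_Ici]; linarith [hx.2])
  exact h1.add h2

lemma continuousOn_pressure (h : Regime κ T₁ T₂ η) (hS : IsScaledSource T₁ T₂ B S) :
    ContinuousOn (pressure κ T₁ T₂ S) (Icc 0 1) := by
  have h1 := (h.continuousOn_integral_sq_mul_wave hS).mono (Icc_subset_Ici_self : Icc (0 : ℝ) 1 ⊆ _)
  have h2 := (h.symm.continuousOn_integral_sq_mul_wave hS.reflected).comp
    (f := fun x : ℝ => 1 - x) (s := Icc 0 1) (by fun_prop) (fun x hx => by
      simp only [mem_Ici]; linarith [hx.2])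
  exact h1.add h2

lemma abs_density_sub_le (h : Regime κ T₁ T₂ η) (hS : IsScaledSource T₁ T₂ 2 S)
    (hm : ∫ y in (0 : ℝ)..1, ∫ v in Ioi (0 : ℝ), S y v = 1 / 2) {x : ℝ} (hx : x ∈ Icc (0 : ℝ) 1) :
    |density κ T₁ T₂ S x - 1| ≤ 14 * η := by
  have h1 := abs_le.1 (h.abs_integral_wave_sub_le hS hm hx.1 hx.2)
  have h2 := abs_le.1 (h.symm.abs_integral_wave_sub_le hS.reflected
    ((integral_reflect S).trans hm) (sub_nonneg.2 hx.2) (sub_le_self 1 hx.1))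
  have h3 := h.share_add_share
  have h4 : 10 * η * share T₁ T₂ + 10 * η * share T₂ T₁ = 10 * η := by rw [← mul_add, h3, mul_one]
  unfold density
  rw [abs_le]
  constructor <;> linarith

lemma abs_pressure_sub_le (h : Regime κ T₁ T₂ η) (hS : IsScaledSource T₁ T₂ 2 S)
    (hm : ∫ y in (0 : ℝ)..1, ∫ v in Ioi (0 : ℝ), S y v = 1 / 2) {x : ℝ} (hx : x ∈ Icc (0 : ℝ) 1) :
    |pressure κ T₁ T₂ S x - √(T₁ * T₂)| ≤ 14 * η * √(T₁ * T₂) := by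
  have h1 := abs_le.1 (h.abs_integral_sq_mul_wave_sub_le hS hm hx.1 hx.2)
  have h2 := abs_le.1 (h.symm.abs_integral_sq_mul_wave_sub_le hS.reflected
    ((integral_reflect S).trans hm) (sub_nonneg.2 hx.2) (sub_le_self 1 hx.1))
  rw [mul_comm T₂ T₁] at h2
  have h3 := h.share_add_share
  have h4 : share T₁ T₂ * √(T₁ * T₂) + share T₂ T₁ * √(T₁ * T₂) = √(T₁ * T₂) := by
    rw [← add_mul, h3, one_mul]
  have h5 : (10 * η * share T₂ T₁ + 2 * η) * √(T₁ * T₂) +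
      (10 * η * share T₁ T₂ + 2 * η) * √(T₁ * T₂) = 14 * η * √(T₁ * T₂) := by
    linear_combination 10 * η * √(T₁ * T₂) * h3
  unfold pressure
  rw [abs_le]
  constructor <;> linarith

lemma abs_density_sub_density_le (h : Regime κ T₁ T₂ η) (hS : IsScaledSource T₁ T₂ 2 S)
    (hS' : IsScaledSource T₁ T₂ 2 S')
    (hd : IsScaledSource T₁ T₂ B fun y v => S y v - S' y v)
    (hm : ∫ y in (0 : ℝ)..1, ∫ v in Ioi (0 : ℝ), (S y v - S' y v) = 0) {x : ℝ}
    (hx : x ∈ Icc (0 : ℝ) 1) :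
    |density κ T₁ T₂ S x - density κ T₁ T₂ S' x| ≤ 8 * B * η := by
  have hx' := sub_nonneg.2 hx.2
  have h1 := abs_le.1 (h.abs_integral_wave_le hd hm hx.1 hx.2)
  have h2 := abs_le.1 (h.symm.abs_integral_wave_le hd.reflected
    ((integral_reflect _).trans hm) hx' (sub_le_self 1 hx.1))
  have h3 : reflect (fun y v => S y v - S' y v) = fun y v => reflect S y v - reflect S' y v := rfl
  simp only [h3, h.wave_sub hS hS', h.symm.wave_sub hS.reflected hS'.reflected] at h1 h2
  rw [integral_sub (h.integrableOn_wave hS hx.1) (h.integrableOn_wave hS' hx.1)] at h1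
  rw [integral_sub (h.symm.integrableOn_wave hS.reflected hx')
    (h.symm.integrableOn_wave hS'.reflected hx')] at h2
  unfold density
  rw [abs_le]
  constructor <;> linarith

lemma abs_pressure_sub_pressure_le (h : Regime κ T₁ T₂ η) (hS : IsScaledSource T₁ T₂ 2 S)
    (hS' : IsScaledSource T₁ T₂ 2 S')
    (hd : IsScaledSource T₁ T₂ B fun y v => S y v - S' y v)
    (hm : ∫ y in (0 : ℝ)..1, ∫ v in Ioi (0 : ℝ), (S y v - S' y v) = 0) {x : ℝ}
    (hx : x ∈ Icc (0 : ℝ) 1) :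
    |pressure κ T₁ T₂ S x - pressure κ T₁ T₂ S' x| ≤ 8 * B * η * √(T₁ * T₂) := by
  have hx' := sub_nonneg.2 hx.2
  have h1 := abs_le.1 (h.abs_integral_sq_mul_wave_le hd hm hx.1 hx.2)
  have h2 := abs_le.1 (h.symm.abs_integral_sq_mul_wave_le hd.reflected
    ((integral_reflect _).trans hm) hx' (sub_le_self 1 hx.1))
  have h3 : reflect (fun y v => S y v - S' y v) = fun y v => reflect S y v - reflect S' y v := rfl
  simp only [h3, h.wave_sub hS hS', h.symm.wave_sub hS.reflected hS'.reflected, mul_sub] at h1 h2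
  rw [integral_sub (h.integrableOn_sq_mul_wave hS hx.1) (h.integrableOn_sq_mul_wave hS' hx.1)] at h1
  rw [integral_sub (h.symm.integrableOn_sq_mul_wave hS.reflected hx')
    (h.symm.integrableOn_sq_mul_wave hS'.reflected hx'), mul_comm T₂ T₁] at h2
  unfold pressure
  rw [abs_le]
  constructor <;> linarith

lemma flux_one (h : Regime κ T₁ T₂ η) (hS : IsScaledSource T₁ T₂ B S) :
    κ * (amp κ T₂ T₁ (reflect S) - amp κ T₁ T₂ S) = ∫ y in (0 : ℝ)..1,
      ((∫ v in Ioi (0 : ℝ), S y v) - ∫ v in Ioi (0 : ℝ), wave κ T₁ T₂ S y v) := by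
  have h1 := IsSource.flux_balance (A := amp κ T₁ T₂ S) hS h.κ_pos h.left_pos h.bulk_pos
    zero_le_one
  rw [IsSource.integral_id_mul_half_one hS h.κ_pos h.left_pos h.bulk_pos] at h1
  have h2 := h.symm.amp_eq_add (reflect S)
  rw [reflect_reflect] at h2
  unfold wave
  rw [← h1, h2]
  ring

lemma intervalIntegrable_wave (h : Regime κ T₁ T₂ η) (hS : IsScaledSource T₁ T₂ B S) {x : ℝ}
    (hx : 0 ≤ x) :
    IntervalIntegrable (fun y => ∫ v in Ioi (0 : ℝ), wave κ T₁ T₂ S y v) volume 0 x := by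
  refine ((h.continuousOn_integral_wave hS).mono ?_).intervalIntegrable
  rw [uIcc_of_le hx]
  exact Icc_subset_Ici_self

/-- The transport and the wall reflections preserve the total mass. -/
lemma integral_density (h : Regime κ T₁ T₂ η) (hS : IsScaledSource T₁ T₂ B S) :
    ∫ x in (0 : ℝ)..1, density κ T₁ T₂ S x =
      2 * ∫ y in (0 : ℝ)..1, ∫ v in Ioi (0 : ℝ), S y v := by
  have h1 := h.flux_one hS
  have h2 := h.symm.flux_one hS.reflected
  rw [reflect_reflect] at h2
  have i1 := h.intervalIntegrable_wave hS zero_le_one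
  have i2 := h.symm.intervalIntegrable_wave hS.reflected zero_le_one
  rw [intervalIntegral.integral_sub (IsSource.intervalIntegrable_integral hS h.bulk_pos zero_le_one)
    i1] at h1
  rw [intervalIntegral.integral_sub (IsSource.intervalIntegrable_integral hS.reflected
    h.symm.bulk_pos zero_le_one) i2, integral_reflect] at h2
  have i3 : IntervalIntegrable
      (fun x => ∫ v in Ioi (0 : ℝ), wave κ T₂ T₁ (reflect S) (1 - x) v) volume 0 1 := by
    have := i2.comp_sub_left 1
    simp only [sub_zero, sub_self] at this
    exact this.symm
  have h3 := intervalIntegral.integral_comp_sub_left (a := 0) (b := 1)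
    (fun x => ∫ v in Ioi (0 : ℝ), wave κ T₂ T₁ (reflect S) x v) 1
  simp only [sub_zero, sub_self] at h3
  unfold density
  rw [intervalIntegral.integral_add i1 i3, h3]
  linarith

/-- If the density is that of the source, then the momentum vanishes. -/
lemma momentum_eq_zero (h : Regime κ T₁ T₂ η) (hS : IsScaledSource T₁ T₂ B S)
    (hd : ∀ y ∈ Icc (0 : ℝ) 1, density κ T₁ T₂ S y = 2 * ∫ v in Ioi (0 : ℝ), S y v) {x : ℝ}
    (hx : x ∈ Icc (0 : ℝ) 1) :
    ∫ v in Ioi (0 : ℝ), v * wave κ T₁ T₂ S x v =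
      ∫ v in Ioi (0 : ℝ), v * wave κ T₂ T₁ (reflect S) (1 - x) v := by
  have hx' := sub_nonneg.2 hx.2
  have h1 : κ * ((∫ v in Ioi (0 : ℝ), v * wave κ T₁ T₂ S x v) - amp κ T₁ T₂ S) = _ :=
    IsSource.flux_balance (A := amp κ T₁ T₂ S) hS h.κ_pos h.left_pos h.bulk_pos hx.1
  have h2 : κ * ((∫ v in Ioi (0 : ℝ), v * wave κ T₂ T₁ (reflect S) (1 - x) v) -
      amp κ T₂ T₁ (reflect S)) = _ :=
    IsSource.flux_balance (A := amp κ T₂ T₁ (reflect S)) hS.reflected h.κ_pos h.right_pos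
    h.symm.bulk_pos hx'
  have h3 := h.flux_one hS
  have i : ∀ x, 0 ≤ x → IntervalIntegrable (fun y => (∫ v in Ioi (0 : ℝ), S y v) -
      ∫ v in Ioi (0 : ℝ), wave κ T₁ T₂ S y v) volume 0 x := fun x hx =>
    (IsSource.intervalIntegrable_integral hS h.bulk_pos hx).sub (h.intervalIntegrable_wave hS hx)
  have h4 := intervalIntegral.integral_interval_sub_left (i 1 zero_le_one) (i x hx.1)
  have h5 : ∫ y in (0 : ℝ)..(1 - x), ((∫ v in Ioi (0 : ℝ), reflect S y v) -
      ∫ v in Ioi (0 : ℝ), half κ T₂ (amp κ T₂ T₁ (reflect S)) (reflect S) y v) =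
      - ∫ y in x..1, ((∫ v in Ioi (0 : ℝ), S y v) - ∫ v in Ioi (0 : ℝ), wave κ T₁ T₂ S y v) := by
    have h6 := intervalIntegral.integral_comp_sub_left (a := x) (b := 1)
      (fun y => (∫ v in Ioi (0 : ℝ), reflect S y v) -
        ∫ v in Ioi (0 : ℝ), wave κ T₂ T₁ (reflect S) y v) 1
    rw [sub_self] at h6
    refine h6.symm.trans ?_
    rw [← intervalIntegral.integral_neg]
    refine intervalIntegral.integral_congr fun y hy => ?_
    rw [uIcc_of_le hx.2] at hy
    have h7 := hd y ⟨hx.1.trans hy.1, hy.2⟩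
    unfold density at h7
    simp only [reflect, sub_sub_cancel] at h7 ⊢
    linarith
  rw [h5] at h2
  unfold wave at h3 h4 h2
  have h8 := h.κ_pos
  have h9 : κ * (∫ v in Ioi (0 : ℝ), v * wave κ T₁ T₂ S x v) =
      κ * ∫ v in Ioi (0 : ℝ), v * wave κ T₂ T₁ (reflect S) (1 - x) v := by
    unfold wave at h1 ⊢
    linarith
  exact mul_left_cancel₀ h8.ne' h9

end Regime

/-- Extension of a function on `[0, 1]` by constants. -/
noncomputable def clampExt (u : Icc (0 : ℝ) 1 → ℝ) (x : ℝ) : ℝ := u (projIcc 0 1 zero_le_one x)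

lemma clampExt_of_mem (u : Icc (0 : ℝ) 1 → ℝ) {x : ℝ} (hx : x ∈ Icc (0 : ℝ) 1) :
    clampExt u x = u ⟨x, hx⟩ := by
  rw [clampExt, projIcc_of_mem zero_le_one hx]

lemma continuous_clampExt (u : C(Icc (0 : ℝ) 1, ℝ)) : Continuous (clampExt u) :=
  u.continuous.comp continuous_projIcc

lemma continuous_integral_clampExt :
    Continuous fun u : C(Icc (0 : ℝ) 1, ℝ) => ∫ y in (0 : ℝ)..1, clampExt u y := by
  refine (LipschitzWith.of_dist_le_mul (K := 1) fun u w => ?_).continuous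
  rw [Real.dist_eq, ← intervalIntegral.integral_sub
    ((continuous_clampExt u).intervalIntegrable _ _)
    ((continuous_clampExt w).intervalIntegrable _ _), ← Real.norm_eq_abs]
  refine (intervalIntegral.norm_integral_le_of_norm_le_const (C := dist u w) fun y _ => ?_).trans ?_
  · exact ContinuousMap.dist_apply_le_dist (f := u) (g := w) _
  · simp

/-- Contraction principle for maps on profiles. -/
theorem exists_fixed_profile (Φ Ψ : (ℝ → ℝ) → (ℝ → ℝ) → ℝ → ℝ)
    (hΦc : ∀ r θ, IsProfile r θ → ContinuousOn (Φ r θ) (Icc 0 1))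
    (hΨc : ∀ r θ, IsProfile r θ → ContinuousOn (Ψ r θ) (Icc 0 1))
    (hΦ : ∀ r θ, IsProfile r θ → ∀ x ∈ Icc (0 : ℝ) 1, Φ r θ x ∈ Icc (1 / 2 : ℝ) 2)
    (hΨ : ∀ r θ, IsProfile r θ → ∀ x ∈ Icc (0 : ℝ) 1, Ψ r θ x ∈ Icc (1 / 2 : ℝ) 2)
    (hmass : ∀ r θ, IsProfile r θ → ∫ x in (0 : ℝ)..1, Φ r θ x = 1)
    (hlip : ∀ r θ r' θ' d, IsProfile r θ → IsProfile r' θ' → (∀ y, |r y - r' y| ≤ d) →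
      (∀ y, |θ y - θ' y| ≤ d) → ∀ x ∈ Icc (0 : ℝ) 1,
        |Φ r θ x - Φ r' θ' x| ≤ d / 2 ∧ |Ψ r θ x - Ψ r' θ' x| ≤ d / 2) :
    ∃ r θ, IsProfile r θ ∧ ∀ x ∈ Icc (0 : ℝ) 1, r x = Φ r θ x ∧ θ x = Ψ r θ x := by
  let s : Set (C(Icc (0 : ℝ) 1, ℝ) × C(Icc (0 : ℝ) 1, ℝ)) :=
    {p | (∀ x, p.1 x ∈ Icc (1 / 2 : ℝ) 2) ∧ (∀ x, p.2 x ∈ Icc (1 / 2 : ℝ) 2) ∧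
      ∫ y in (0 : ℝ)..1, clampExt p.1 y = 1}
  have hs : IsClosed s := by
    have h1 : IsClosed {p : C(Icc (0 : ℝ) 1, ℝ) × C(Icc (0 : ℝ) 1, ℝ) |
        ∀ x, p.1 x ∈ Icc (1 / 2 : ℝ) 2} := by
      rw [Set.ofPred_forall]
      exact isClosed_iInter fun x => isClosed_Icc.preimage
        ((continuous_eval_const x).comp continuous_fst)
    have h2 : IsClosed {p : C(Icc (0 : ℝ) 1, ℝ) × C(Icc (0 : ℝ) 1, ℝ) |
        ∀ x, p.2 x ∈ Icc (1 / 2 : ℝ) 2} := by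
      rw [Set.ofPred_forall]
      exact isClosed_iInter fun x => isClosed_Icc.preimage
        ((continuous_eval_const x).comp continuous_snd)
    exact h1.inter (h2.inter
      (isClosed_eq (continuous_integral_clampExt.comp continuous_fst) continuous_const))
  have hp : ∀ p : s, IsProfile (clampExt p.1.1) (clampExt p.1.2) := fun p =>
    ⟨continuous_clampExt _, continuous_clampExt _, fun _ => p.2.1 _, fun _ => p.2.2.1 _, p.2.2.2⟩
  have := hs.completeSpace_coe
  have : Nonempty s := ⟨⟨(1, 1), fun _ => by norm_num, fun _ => by norm_num, by simp [clampExt]⟩⟩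
  let F : s → s := fun p => ⟨(⟨_, (hΦc _ _ (hp p)).domRestrict⟩, ⟨_, (hΨc _ _ (hp p)).domRestrict⟩),
    fun x => hΦ _ _ (hp p) x x.2, fun x => hΨ _ _ (hp p) x x.2, by
      refine Eq.trans (intervalIntegral.integral_congr fun x hx => ?_) (hmass _ _ (hp p))
      rw [uIcc_of_le zero_le_one] at hx
      exact clampExt_of_mem _ hx⟩
  have hF : ContractingWith (1 / 2) F := by
    refine ⟨by norm_num, LipschitzWith.of_dist_le_mul fun p q => ?_⟩
    have h1 := hlip _ _ _ _ (dist p q) (hp p) (hp q)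
      (fun y => (ContinuousMap.dist_apply_le_dist (f := p.1.1) (g := q.1.1) _).trans
        (le_max_left _ _))
      (fun y => (ContinuousMap.dist_apply_le_dist (f := p.1.2) (g := q.1.2) _).trans
        (le_max_right _ _))
    have h2 : ((1 / 2 : NNReal) : ℝ) * dist p q = dist p q / 2 := by
      push_cast
      ring
    rw [h2]
    have h3 : 0 ≤ dist p q / 2 := by positivity
    exact max_le ((ContinuousMap.dist_le h3).2 fun x => (h1 x x.2).1)
      ((ContinuousMap.dist_le h3).2 fun x => (h1 x x.2).2)
  have hfix := hF.fixedPoint_isFixedPt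
  set p := ContractingWith.fixedPoint F hF
  refine ⟨_, _, hp p, fun x hx => ?_⟩
  have h1 : (F p).1 = p.1 := congrArg Subtype.val hfix
  constructor
  · rw [clampExt_of_mem _ hx]
    exact (congrArg (fun q => q.1 ⟨x, hx⟩) h1).symm
  · rw [clampExt_of_mem _ hx]
    exact (congrArg (fun q => q.2 ⟨x, hx⟩) h1).symm

namespace Regime

variable {κ T₁ T₂ η : ℝ}

/-- Self-consistent profiles of the nonlinear problem. -/
theorem exists_profile (h : Regime κ T₁ T₂ η) : ∃ r θ, IsProfile r θ ∧
    ∀ x ∈ Icc (0 : ℝ) 1,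
      density κ T₁ T₂ (maxwellSource √(T₁ * T₂) r θ) x = r x ∧
      pressure κ T₁ T₂ (maxwellSource √(T₁ * T₂) r θ) x = √(T₁ * T₂) * (r x * θ x) := by
  have ht := h.mean_pos
  set t := √(T₁ * T₂) with htdef
  have hη := h.η_nonneg
  have hη1 := h.η_le
  have hS : ∀ r θ, IsProfile r θ → IsScaledSource T₁ T₂ 2 (maxwellSource t r θ) :=
    fun r θ hp => hp.isSource ht
  have hρ : ∀ r θ, IsProfile r θ → ∀ x ∈ Icc (0 : ℝ) 1,
      |density κ T₁ T₂ (maxwellSource t r θ) x - 1| ≤ 14 * η := fun r θ hp x hx =>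
    h.abs_density_sub_le (hS r θ hp) (hp.mass_maxwellSource ht) hx
  have hP : ∀ r θ, IsProfile r θ → ∀ x ∈ Icc (0 : ℝ) 1,
      |pressure κ T₁ T₂ (maxwellSource t r θ) x - t| ≤ 14 * η * t := fun r θ hp x hx =>
    h.abs_pressure_sub_le (hS r θ hp) (hp.mass_maxwellSource ht) hx
  have hρ0 : ∀ r θ, IsProfile r θ → ∀ x ∈ Icc (0 : ℝ) 1,
      0 < density κ T₁ T₂ (maxwellSource t r θ) x := fun r θ hp x hx => by
    linarith [(abs_le.1 (hρ r θ hp x hx)).1]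
  obtain ⟨r, θ, hp, hfix⟩ := exists_fixed_profile
    (fun r θ => density κ T₁ T₂ (maxwellSource t r θ))
    (fun r θ x => pressure κ T₁ T₂ (maxwellSource t r θ) x / t /
      density κ T₁ T₂ (maxwellSource t r θ) x)
    (fun r θ hp => h.continuousOn_density (hS r θ hp))
    (fun r θ hp => ((h.continuousOn_pressure (hS r θ hp)).div_const t).div
      (h.continuousOn_density (hS r θ hp)) fun x hx => (hρ0 r θ hp x hx).ne')
    (fun r θ hp x hx => by
      have h1 := abs_le.1 (hρ r θ hp x hx)
      constructor <;> linarith)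
    (fun r θ hp x hx => by
      have h1 := abs_le.1 (hρ r θ hp x hx)
      have h2 := abs_le.1 (hP r θ hp x hx)
      have h3 := hρ0 r θ hp x hx
      have h4 : 14 * η * t ≤ 1 / 200 * t := by gcongr; linarith
      rw [div_div]
      constructor
      · rw [le_div_iff₀ (by positivity)]
        nlinarith
      · rw [div_le_iff₀ (by positivity)]
        nlinarith)
    (fun r θ hp => by
      rw [h.integral_density (hS r θ hp), hp.mass_maxwellSource ht]
      norm_num)
    (fun r θ r' θ' d hp hp' hr hθ x hx => by
      have hd : IsScaledSource T₁ T₂ (35 * d)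
        (fun y v => maxwellSource t r θ y v - maxwellSource t r' θ' y v) :=
        hp.isSource_sub hp' ht hr hθ
      have hm : ∫ y in (0 : ℝ)..1, ∫ v in Ioi (0 : ℝ),
          (maxwellSource t r θ y v - maxwellSource t r' θ' y v) = 0 := by
        have e : ∀ y, ∫ v in Ioi (0 : ℝ),
            (maxwellSource t r θ y v - maxwellSource t r' θ' y v) = r y / 2 - r' y / 2 := fun y => by
          rw [integral_sub (IsSource.integrableOn (hS r θ hp) h.bulk_pos y)
            (IsSource.integrableOn (hS r' θ' hp') h.bulk_pos y), hp.integral_maxwellSource ht,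
            hp'.integral_maxwellSource ht]
        simp_rw [e]
        rw [intervalIntegral.integral_sub
          ((hp.continuous_density.div_const 2).intervalIntegrable _ _)
          ((hp'.continuous_density.div_const 2).intervalIntegrable _ _),
          intervalIntegral.integral_div, intervalIntegral.integral_div, hp.mass, hp'.mass, sub_self]
      have hd0 : 0 ≤ d := (abs_nonneg _).trans (hr 0)
      have h1 := h.abs_density_sub_density_le (hS r θ hp) (hS r' θ' hp') hd hm hx
      have h2 := h.abs_pressure_sub_pressure_le (hS r θ hp) (hS r' θ' hp') hd hm hx
      have h3 := abs_le.1 (hρ r θ hp x hx)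
      have h4 := abs_le.1 (hρ r' θ' hp' x hx)
      have h5 := abs_le.1 (hP r' θ' hp' x hx)
      have h0 := hρ0 r θ hp x hx
      have h0' := hρ0 r' θ' hp' x hx
      have h6 : 8 * (35 * d) * η ≤ d / 10 := by nlinarith
      refine ⟨h1.trans (by linarith), ?_⟩
      rw [← htdef] at h2
      set D := density κ T₁ T₂ (maxwellSource t r θ) x
      set D' := density κ T₁ T₂ (maxwellSource t r' θ') x
      set P := pressure κ T₁ T₂ (maxwellSource t r θ) x
      set P' := pressure κ T₁ T₂ (maxwellSource t r' θ') x
      have e : P / t / D - P' / t / D' = ((P - P') * D' - P' * (D - D')) / (t * D * D') := by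
        field_simp
        ring
      rw [e, abs_div, abs_of_pos (by positivity : 0 < t * D * D'), div_le_iff₀ (by positivity)]
      have h7 : |P'| ≤ 2 * t := by
        rw [abs_le]
        constructor <;> nlinarith
      calc |(P - P') * D' - P' * (D - D')| ≤ |(P - P') * D'| + |P' * (D - D')| := abs_sub _ _
        _ = |P - P'| * D' + |P'| * |D - D'| := by rw [abs_mul, abs_mul, abs_of_pos h0']
        _ ≤ (d / 10 * t) * (21 / 20) + (2 * t) * (d / 10) := by
          gcongr
          · exact h2.trans (by gcongr)
          · linarith
          · linarith
        _ ≤ d / 2 * (t * (9 / 10) * (9 / 10)) := by nlinarith [mul_nonneg hd0 ht.le]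
        _ ≤ d / 2 * (t * D * D') := by
          gcongr <;> linarith)
  refine ⟨r, θ, hp, fun x hx => ?_⟩
  obtain ⟨h1, h2⟩ := hfix x hx
  refine ⟨h1.symm, ?_⟩
  have h0 := hρ0 r θ hp x hx
  rw [h2, h1]
  field_simp

lemma abs_profile_sub_le (h : Regime κ T₁ T₂ η) {r θ : ℝ → ℝ} (hp : IsProfile r θ) {x : ℝ}
    (hx : x ∈ Icc (0 : ℝ) 1)
    (hr : density κ T₁ T₂ (maxwellSource √(T₁ * T₂) r θ) x = r x)
    (hP : pressure κ T₁ T₂ (maxwellSource √(T₁ * T₂) r θ) x = √(T₁ * T₂) * (r x * θ x)) :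
    |r x - 1| ≤ 14 * η ∧ |θ x - 1| ≤ 30 * η := by
  have ht := h.mean_pos
  have h1 := h.abs_density_sub_le (hp.isSource ht) (hp.mass_maxwellSource ht) hx
  have h2 := h.abs_pressure_sub_le (hp.isSource ht) (hp.mass_maxwellSource ht) hx
  rw [hr] at h1
  have e : √(T₁ * T₂) * (r x * θ x) - √(T₁ * T₂) = √(T₁ * T₂) * (r x * θ x - 1) := by ring
  rw [hP, e, abs_mul, abs_of_pos ht, mul_comm, mul_le_mul_iff_left₀ ht] at h2
  refine ⟨h1, ?_⟩
  have hη := h.η_nonneg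
  have hη1 := h.η_le
  have h3 := (abs_le.1 h1).1
  have h4 : |r x * (θ x - 1)| ≤ 28 * η := by
    rw [show r x * (θ x - 1) = (r x * θ x - 1) - (r x - 1) by ring]
    exact (abs_sub _ _).trans (by linarith)
  rw [abs_mul, abs_of_pos (by linarith : 0 < r x)] at h4
  nlinarith [abs_nonneg (θ x - 1)]

end Regime

lemma rpow_neg_quarter {κ τ : ℝ} (hκ : 0 < κ) (hτ : 0 < τ) :
    (κ ^ 2 * τ) ^ (-(1 : ℝ) / 4) = √((κ * √τ)⁻¹) := by
  have h : 0 < κ * √τ := by positivity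
  have e : κ ^ 2 * τ = (κ * √τ) ^ (2 : ℝ) := by
    rw [Real.rpow_two, mul_pow, Real.sq_sqrt hτ.le]
  rw [e, ← Real.rpow_mul h.le, Real.sqrt_eq_rpow (κ * √τ)⁻¹, ← Real.rpow_neg_one,
    ← Real.rpow_mul h.le]
  norm_num

/-- Large Knudsen numbers belong to the nearly free molecular regime. -/
theorem exists_regime : ∃ K : ℝ, 1 ≤ K ∧ ∀ κ T₁ T₂ : ℝ, 0 < κ → 0 < T₁ → T₁ ≤ T₂ →
    (4000 * K) ^ 4 ≤ κ ^ 2 * T₁ → Regime κ T₁ T₂ (K * (κ ^ 2 * T₁) ^ (-(1 : ℝ) / 4)) := by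
  obtain ⟨K, hK, hint⟩ := exists_integral_sqrt_mul_gauss_le
  refine ⟨64 * K, by linarith, fun κ T₁ T₂ hκ h1 h12 hΘ => ?_⟩
  have h2 : 0 < T₂ := h1.trans_le h12
  have hK0 : 0 < 4000 * (64 * K) := by linarith
  have hε : (κ ^ 2 * T₁) ^ (-(1 : ℝ) / 4) ≤ (4000 * (64 * K))⁻¹ := by
    refine (Real.rpow_le_rpow_of_nonpos (by positivity) hΘ (by norm_num)).trans_eq ?_
    rw [← Real.rpow_natCast, ← Real.rpow_mul hK0.le, ← Real.rpow_neg_one]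
    norm_num
  rw [rpow_neg_quarter hκ h1] at hε ⊢
  set ε := √((κ * √T₁)⁻¹) with hεdef
  have hε0 : 0 ≤ ε := Real.sqrt_nonneg _
  have hε1 : ε ≤ 1 := hε.trans (inv_le_one_of_one_le₀ (by linarith))
  have hsq : ε ^ 2 = (κ * √T₁)⁻¹ := Real.sq_sqrt (by positivity)
  have hzero : ∀ τ, T₁ ≤ τ → ∫ v in Ioi (0 : ℝ), √((κ * v)⁻¹) * gauss τ v ≤ K * √τ * ε := by
    intro τ hτ
    have : 0 < √T₁ := Real.sqrt_pos.2 h1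
    refine (hint κ τ hκ (h1.trans_le hτ)).trans ?_
    rw [hεdef]
    gcongr
  have htwo : ∀ τ, T₁ ≤ τ → ∫ v in Ioi (0 : ℝ), √((κ * v)⁻¹) * (v ^ 2 * gauss τ v) ≤
      8 * K * ε * (τ * √τ) := by
    intro τ hτ
    have hτ0 : 0 < τ := h1.trans_le hτ
    have e2 : √(2 * τ) ≤ 2 * √τ := by
      rw [Real.sqrt_le_left (by positivity), mul_pow, Real.sq_sqrt hτ0.le]
      linarith
    calc ∫ v in Ioi (0 : ℝ), √((κ * v)⁻¹) * (v ^ 2 * gauss τ v)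
        ≤ ∫ v in Ioi (0 : ℝ), 4 * τ * (√((κ * v)⁻¹) * gauss (2 * τ) v) := by
          refine setIntegral_mono_on (integrableOn_sqrt_mul_sq_mul_gauss hκ hτ0)
            ((integrableOn_sqrt_mul_gauss hκ (by positivity)).const_mul _) measurableSet_Ioi
            fun v _ => ?_
          rw [mul_left_comm (4 * τ)]
          exact mul_le_mul_of_nonneg_left (sq_mul_gauss_le hτ0 v) (Real.sqrt_nonneg _)
      _ = 4 * τ * ∫ v in Ioi (0 : ℝ), √((κ * v)⁻¹) * gauss (2 * τ) v := integral_const_mul _ _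
      _ ≤ 4 * τ * (K * (2 * √τ) * ε) := by
          gcongr
          exact (hzero _ (by linarith)).trans (by gcongr)
      _ = 8 * K * ε * (τ * √τ) := by ring
  have hwall : ∀ τ, T₁ ≤ τ → 1 - Cwall κ τ ≤ 64 * K * ε := by
    intro τ hτ
    have hτ0 : 0 < τ := h1.trans_le hτ
    have hs : 0 < √T₁ := Real.sqrt_pos.2 h1
    have hs' : 0 < √τ := Real.sqrt_pos.2 hτ0
    have h3 : 1 - Cwall κ τ ≤ √(π / 2) * (κ * √τ)⁻¹ := by
      have e : √(π / 2) * (κ * √τ)⁻¹ = (τ⁻¹ * (√(π / 2) * √τ)) / κ := by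
        nth_rw 2 [← Real.sq_sqrt hτ0.le]
        field_simp
      rw [e, le_div_iff₀ hκ, mul_comm]
      exact one_sub_Cwall_le hκ hτ0
    have h4 : √(π / 2) ≤ 2 := by
      rw [Real.sqrt_le_left (by norm_num)]
      linarith [Real.pi_le_four]
    calc 1 - Cwall κ τ ≤ √(π / 2) * (κ * √τ)⁻¹ := h3
      _ ≤ 2 * (κ * √T₁)⁻¹ := by gcongr
      _ = 2 * ε ^ 2 := by rw [hsq]
      _ ≤ 64 * K * ε := by nlinarith
  have hmean : T₁ ≤ √(T₁ * T₂) := Real.le_sqrt_of_sq_le (by nlinarith)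
  have ht : 0 < √(T₁ * T₂) := h1.trans_le hmean
  have h4 : √(4 * √(T₁ * T₂)) = 2 * √(√(T₁ * T₂)) := by
    rw [Real.sqrt_mul (by norm_num), show (4 : ℝ) = 2 ^ 2 by norm_num, Real.sqrt_sq (by norm_num)]
  have hKε : 0 ≤ K * ε := by positivity
  exact
  { κ_pos := hκ
    left_pos := h1
    right_pos := h2
    η_nonneg := by positivity
    η_le := by
      have := mul_le_mul_of_nonneg_left hε (by linarith : 0 ≤ 64 * K)
      refine this.trans_eq ?_
      field_simp
    left_zero := (hzero _ le_rfl).trans (by nlinarith [Real.sqrt_nonneg T₁])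
    right_zero := (hzero _ h12).trans (by nlinarith [Real.sqrt_nonneg T₂])
    left_two := (htwo _ le_rfl).trans (by gcongr; linarith)
    right_two := (htwo _ h12).trans (by gcongr; linarith)
    bulk_zero := (hzero _ (by linarith)).trans (by
      rw [h4]
      nlinarith [mul_nonneg hKε (Real.sqrt_nonneg √(T₁ * T₂))])
    bulk_two := (htwo _ (by linarith)).trans_eq (by rw [h4]; ring)
    left_wall := hwall _ le_rfl
    right_wall := hwall _ h12 }

/-- The function equal to `a` on the right half-line and to the mirror image of `b` on the left. -/
noncomputable def glue (a b : ℝ → ℝ) (v : ℝ) : ℝ :=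
  if 0 < v then a v else if v < 0 then b (-v) else 0

lemma glue_of_pos (a b : ℝ → ℝ) {v : ℝ} (hv : 0 < v) : glue a b v = a v := if_pos hv

lemma glue_of_neg (a b : ℝ → ℝ) {v : ℝ} (hv : v < 0) : glue a b v = b (-v) := by
  rw [glue, if_neg hv.not_gt, if_pos hv]

lemma glue_nonneg {a b : ℝ → ℝ} (ha : ∀ v, 0 < v → 0 ≤ a v) (hb : ∀ v, 0 < v → 0 ≤ b v) (v : ℝ) :
    0 ≤ glue a b v := by
  unfold glue
  split_ifs with h h'
  exacts [ha v h, hb _ (neg_pos.2 h'), le_rfl]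

lemma integral_glue {a b : ℝ → ℝ} (ha : IntegrableOn a (Ioi 0)) (hb : IntegrableOn b (Ioi 0)) :
    ∫ v, glue a b v = (∫ v in Ioi (0 : ℝ), a v) + ∫ v in Ioi (0 : ℝ), b v := by
  have ea : ∀ᵐ v ∂(volume.restrict (Ioi (0 : ℝ))), a v = glue a b v :=
    ae_restrict_of_forall_mem measurableSet_Ioi fun v hv => (glue_of_pos a b hv).symm
  have eb : ∀ᵐ v ∂(volume.restrict (Iic (0 : ℝ))), b (-v) = glue a b v := by
    rw [← restrict_Iio_eq_restrict_Iic]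
    exact ae_restrict_of_forall_mem measurableSet_Iio fun v hv => (glue_of_neg a b hv).symm
  have hb' : IntegrableOn (fun v => b (-v)) (Iic 0) := by
    rw [← neg_zero] at hb
    exact ((integrableOn_Ici_iff_integrableOn_Ioi (by simp)).2 hb).comp_neg_Iic
  rw [← intervalIntegral.integral_Iic_add_Ioi (b := 0) (Integrable.congr hb' eb)
    (Integrable.congr ha ea), ← integral_congr_ae ea, ← integral_congr_ae eb,
    integral_comp_neg_Iic, neg_zero, add_comm]

lemma mul_glue (φ a b : ℝ → ℝ) (v : ℝ) :
    φ v * glue a b v = glue (fun v => φ v * a v) (fun v => φ (-v) * b v) v := by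
  simp only [glue, neg_neg]
  split_ifs <;> simp

/-- The distribution on the whole velocity line with source `S`, extended constantly in space. -/
noncomputable def steady (κ T₁ T₂ : ℝ) (S : ℝ → ℝ → ℝ) (x v : ℝ) : ℝ :=
  glue (wave κ T₁ T₂ S (projIcc 0 1 zero_le_one x))
    (wave κ T₂ T₁ (reflect S) (1 - projIcc 0 1 zero_le_one x)) v

lemma steady_of_mem {κ T₁ T₂ : ℝ} {S : ℝ → ℝ → ℝ} {x : ℝ} (hx : x ∈ Icc (0 : ℝ) 1) (v : ℝ) :
    steady κ T₁ T₂ S x v = glue (wave κ T₁ T₂ S x) (wave κ T₂ T₁ (reflect S) (1 - x)) v := by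
  rw [steady, projIcc_of_mem zero_le_one hx]

lemma measurable_steady {κ T₁ T₂ : ℝ} {S : ℝ → ℝ → ℝ} (hS : Measurable (Function.uncurry S)) :
    Measurable (Function.uncurry (steady κ T₁ T₂ S)) := by
  have hR : Measurable (Function.uncurry (reflect S)) :=
    hS.comp ((measurable_const.sub measurable_fst).prodMk measurable_snd)
  have hproj : Measurable fun p : ℝ × ℝ => (projIcc (0 : ℝ) 1 zero_le_one p.1 : ℝ) :=
    (continuous_subtype_val.comp (continuous_projIcc.comp continuous_fst)).measurable
  refine Measurable.ite (measurableSet_lt measurable_const measurable_snd) ?_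
    (Measurable.ite (measurableSet_lt measurable_snd measurable_const) ?_ measurable_const)
  · exact (measurable_half hS).comp (hproj.prodMk measurable_snd)
  · exact (measurable_half hR).comp ((measurable_const.sub hproj).prodMk measurable_snd.neg)

lemma gain_reflect (κ : ℝ) (S : ℝ → ℝ → ℝ) (x v : ℝ) :
    gain κ (reflect S) (1 - x) v =
      ∫ y in x..1, (κ * v)⁻¹ * Real.exp (-(y - x) / (κ * v)) * S y v := by
  have h := intervalIntegral.integral_comp_sub_left (a := 0) (b := 1 - x)
    (fun y => (κ * v)⁻¹ * Real.exp (-(y - x) / (κ * v)) * S y v) 1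
  rw [sub_sub_cancel, sub_zero] at h
  rw [← h]
  refine intervalIntegral.integral_congr fun y _ => ?_
  rw [show 1 - y - x = 1 - x - y by ring]
  rfl

lemma outflow_reflect (κ : ℝ) (S : ℝ → ℝ → ℝ) :
    outflow κ (reflect S) =
      κ⁻¹ * ∫ y in (0 : ℝ)..1, ∫ v in Ioi (0 : ℝ), Real.exp (-y / (κ * v)) * S y v := by
  have h := intervalIntegral.integral_comp_sub_left (a := 0) (b := 1)
    (fun y => ∫ v in Ioi (0 : ℝ), Real.exp (-y / (κ * v)) * S y v) 1
  rw [sub_self, sub_zero] at h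
  rw [← h]
  rfl

section Maxwell

variable {κ T₁ T₂ η t : ℝ} {r θ ρ T : ℝ → ℝ}

lemma mul_integral_Mxw (φ : ℝ → ℝ) {y : ℝ} (hρ : ρ y = r y) (hT : T y = t * θ y) :
    ρ y * ∫ v in Ioi (0 : ℝ), φ v * Mxw (T y) v =
      ∫ v in Ioi (0 : ℝ), φ v * maxwellSource t r θ y v := by
  rw [← integral_const_mul, hρ, hT]
  simp only [maxwellSource, mul_left_comm]

lemma Cplus_eq (hρ : ∀ y ∈ Icc (0 : ℝ) 1, ρ y = r y) (hT : ∀ y ∈ Icc (0 : ℝ) 1, T y = t * θ y) :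
    Cplus κ ρ T = outflow κ (maxwellSource t r θ) := by
  rw [Cplus, outflow, intervalIntegral.integral_of_le zero_le_one, ← integral_Icc_eq_integral_Ioc]
  congr 1
  exact setIntegral_congr_fun measurableSet_Icc fun y hy => mul_integral_Mxw _ (hρ y hy) (hT y hy)

lemma Cminus_eq (hρ : ∀ y ∈ Icc (0 : ℝ) 1, ρ y = r y) (hT : ∀ y ∈ Icc (0 : ℝ) 1, T y = t * θ y) :
    Cminus κ ρ T = outflow κ (reflect (maxwellSource t r θ)) := by
  rw [Cminus, outflow_reflect, intervalIntegral.integral_of_le zero_le_one,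
    ← integral_Icc_eq_integral_Ioc]
  congr 1
  exact setIntegral_congr_fun measurableSet_Icc fun y hy => mul_integral_Mxw _ (hρ y hy) (hT y hy)

/-- The state generated by a Maxwellian source is a mild steady state of the linear equation. -/
theorem Regime.isMildSteadyState (h : Regime κ T₁ T₂ η) (ht : 0 < t) (hp : IsProfile r θ)
    (hρ : ∀ y ∈ Icc (0 : ℝ) 1, ρ y = r y) (hT : ∀ y ∈ Icc (0 : ℝ) 1, T y = t * θ y)
    (hf : ∀ x ∈ Icc (0 : ℝ) 1, ρ x = ∫ v, steady κ T₁ T₂ (maxwellSource t r θ) x v) :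
    IsMildSteadyState κ T₁ T₂ ρ T (steady κ T₁ T₂ (maxwellSource t r θ)) := by
  have hS := hp.isSource ht
  have h4 : 0 < 4 * t := by positivity
  refine ⟨by linarith [h.den_pos], ?_, ?_, hf, fun x hx => ⟨?_, ?_⟩⟩
  · have h1 := (hS.reflected.intervalIntegrable_exp_mul h.κ_pos h4).comp_sub_left 1
    rw [sub_zero, sub_self] at h1
    have h2 := (intervalIntegrable_iff_integrableOn_Icc_of_le zero_le_one).1 h1.symm
    refine h2.congr_fun (fun y hy => ?_) measurableSet_Icc
    rw [mul_integral_Mxw _ (hρ y hy) (hT y hy)]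
    simp only [sub_sub_cancel, reflect]
  · have h2 := (intervalIntegrable_iff_integrableOn_Icc_of_le zero_le_one).1
      (hS.intervalIntegrable_exp_mul h.κ_pos h4)
    refine h2.congr_fun (fun y hy => ?_) measurableSet_Icc
    rw [mul_integral_Mxw _ (hρ y hy) (hT y hy)]
  · refine ae_restrict_of_forall_mem measurableSet_Ioi fun v hv => ?_
    rw [steady_of_mem hx, glue_of_pos _ _ hv, wave, half, amp, Cplus_eq hρ hT, Cminus_eq hρ hT,
      mul_comm (_ / _)]
    congr 1
    refine intervalIntegral.integral_congr fun y hy => ?_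
    rw [uIcc_of_le hx.1] at hy
    have hy' : y ∈ Icc (0 : ℝ) 1 := ⟨hy.1, hy.2.trans hx.2⟩
    simp only [maxwellSource, hρ y hy', hT y hy', mul_assoc]
  · refine ae_restrict_of_forall_mem measurableSet_Iio fun v hv => ?_
    rw [steady_of_mem hx, glue_of_neg _ _ hv, wave, half, amp,
      Cplus_eq hρ hT, Cminus_eq hρ hT, mul_comm (_ / _), reflect_reflect, abs_of_neg hv,
      mul_comm (Cwall κ T₂) (Cwall κ T₁), gain_reflect, wallMxw, wallMxw, neg_sq]
    congr 1
    refine intervalIntegral.integral_congr fun y hy => ?_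
    rw [uIcc_of_le hx.2] at hy
    have hy' : y ∈ Icc (0 : ℝ) 1 := ⟨hx.1.trans hy.1, hy.2⟩
    simp only [maxwellSource, hρ y hy', hT y hy', mul_assoc, Mxw_neg]

end Maxwell

namespace Regime

variable {κ T₁ T₂ η B : ℝ} {S : ℝ → ℝ → ℝ} {x : ℝ}

lemma integral_steady (h : Regime κ T₁ T₂ η) (hS : IsScaledSource T₁ T₂ B S)
    (hx : x ∈ Icc (0 : ℝ) 1) : ∫ v, steady κ T₁ T₂ S x v = density κ T₁ T₂ S x := by
  simp only [steady_of_mem hx]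
  exact integral_glue (h.integrableOn_wave hS hx.1)
    (h.symm.integrableOn_wave hS.reflected (sub_nonneg.2 hx.2))

lemma integral_sq_mul_steady (h : Regime κ T₁ T₂ η) (hS : IsScaledSource T₁ T₂ B S)
    (hx : x ∈ Icc (0 : ℝ) 1) : ∫ v, v ^ 2 * steady κ T₁ T₂ S x v = pressure κ T₁ T₂ S x := by
  simp only [steady_of_mem hx, mul_glue (fun v => v ^ 2), neg_sq]
  exact integral_glue (h.integrableOn_sq_mul_wave hS hx.1)
    (h.symm.integrableOn_sq_mul_wave hS.reflected (sub_nonneg.2 hx.2))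

lemma integral_mul_steady (h : Regime κ T₁ T₂ η) (hS : IsScaledSource T₁ T₂ B S)
    (hd : ∀ y ∈ Icc (0 : ℝ) 1, density κ T₁ T₂ S y = 2 * ∫ v in Ioi (0 : ℝ), S y v)
    (hx : x ∈ Icc (0 : ℝ) 1) : ∫ v, v * steady κ T₁ T₂ S x v = 0 := by
  have hi := h.symm.integrableOn_id_mul_wave hS.reflected (sub_nonneg.2 hx.2)
  simp only [steady_of_mem hx, mul_glue (fun v => v)]
  simp only [neg_mul]
  rw [integral_glue (h.integrableOn_id_mul_wave hS hx.1) hi.fun_neg, integral_neg,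
    h.momentum_eq_zero hS hd hx, add_neg_cancel]

lemma steady_nonneg (h : Regime κ T₁ T₂ η) (hS : IsScaledSource T₁ T₂ 2 S)
    (hS0 : ∀ y v, 0 ≤ S y v)
    (hm : ∫ y in (0 : ℝ)..1, ∫ v in Ioi (0 : ℝ), S y v = 1 / 2) (x v : ℝ) :
    0 ≤ steady κ T₁ T₂ S x v := by
  have hx := (projIcc (0 : ℝ) 1 zero_le_one x).2
  refine glue_nonneg (fun v hv => ?_) (fun v hv => ?_) v
  · exact half_nonneg h.κ_pos h.left_pos (h.amp_pos hS hm).le hv hx.1 fun y => hS0 y v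
  · exact half_nonneg h.κ_pos h.right_pos
      (h.symm.amp_pos hS.reflected ((integral_reflect S).trans hm)).le hv (sub_nonneg.2 hx.2)
      fun y => hS0 (1 - y) v

end Regime

/-- existence of a non-equilibrium steady state for the nonlinear BGK
model with diffusive boundary conditions, together with its properties. -/
theorem nonlinear_BGK_steady_state_exists :
    ∃ Θ γ₀ γ₁ c : ℝ, 1 ≤ Θ ∧ 0 < γ₀ ∧ 0 < γ₁ ∧ 0 < c ∧
      ∀ κ T₁ T₂ : ℝ, 0 < κ → 0 < T₁ → 0 < T₂ → Θ ≤ κ ^ 2 * T₁ → T₁ ≤ T₂ →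
        Real.sqrt (T₁ * T₂) * (1 + γ₀ * (κ ^ 2 * T₁) ^ (-(1 : ℝ) / 4)) ≤ T₂ →
        T₁ ≤ Real.sqrt (T₁ * T₂) * (1 - γ₁ * (κ ^ 2 * T₁) ^ (-(1 : ℝ) / 4)) →
        ∃ f : ℝ → ℝ → ℝ, ∃ ρ Tf : ℝ → ℝ,
          (∀ x v, 0 ≤ f x v) ∧
          Measurable (Function.uncurry f) ∧
          ρ = (fun x => ∫ v, f x v) ∧
          Tf = (fun x => (∫ v, v ^ 2 * f x v) / ρ x) ∧
          -- (i) `f` solves the stationary nonlinear BGK equation in mild form: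
          IsMildSteadyState κ T₁ T₂ ρ Tf f ∧
          -- (ii) unit mass and density close to 1:
          (∫ x in Icc (0 : ℝ) 1, ρ x) = 1 ∧
          (∀ x ∈ Icc (0 : ℝ) 1,
            1 - γ₀ * (κ ^ 2 * T₁) ^ (-(1 : ℝ) / 4) ≤ ρ x ∧
            ρ x ≤ 1 + γ₁ * (κ ^ 2 * T₁) ^ (-(1 : ℝ) / 4)) ∧
          -- (iii) zero momentum:
          (∀ x ∈ Icc (0 : ℝ) 1, (∫ v, v * f x v) = 0) ∧
          -- (iv) temperature and pressure bounds:
          ContinuousOn Tf (Icc 0 1) ∧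
          (∀ x ∈ Icc (0 : ℝ) 1,
            T₁ ≤ Tf x ∧ Tf x ≤ T₂ ∧
            Real.sqrt (T₁ * T₂) * (1 - c * (κ ^ 2 * T₁) ^ (-(1 : ℝ) / 4)) ≤ Tf x ∧
            Tf x ≤ Real.sqrt (T₁ * T₂) * (1 + c * (κ ^ 2 * T₁) ^ (-(1 : ℝ) / 4)) ∧
            c⁻¹ * Real.sqrt (T₁ * T₂) ≤ ρ x * Tf x ∧
            ρ x * Tf x ≤ c * Real.sqrt (T₁ * T₂)) := by
  obtain ⟨K, hK, hregime⟩ := exists_regime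
  refine ⟨(4000 * K) ^ 4, 30 * K, 30 * K, 30 * K, one_le_pow₀ (by linarith), by linarith,
    by linarith, by linarith, fun κ T₁ T₂ hκ hT₁ _ hΘ hT hup hlow => ?_⟩
  have h := hregime κ T₁ T₂ hκ hT₁ hT hΘ
  set ε := (κ ^ 2 * T₁) ^ (-(1 : ℝ) / 4)
  have ht := h.mean_pos
  obtain ⟨r, θ, hp, hfix⟩ := h.exists_profile
  set t := √(T₁ * T₂)
  have hS : IsScaledSource T₁ T₂ 2 (maxwellSource t r θ) := hp.isSource ht
  have hη := h.η_nonneg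
  have hη1 := h.η_le
  have hρ : ∀ x ∈ Icc (0 : ℝ) 1, ∫ v, steady κ T₁ T₂ (maxwellSource t r θ) x v = r x :=
    fun x hx => (h.integral_steady hS hx).trans (hfix x hx).1
  have hTf : ∀ x ∈ Icc (0 : ℝ) 1,
      (∫ v, v ^ 2 * steady κ T₁ T₂ (maxwellSource t r θ) x v) /
        ∫ v, steady κ T₁ T₂ (maxwellSource t r θ) x v = t * θ x := by
    intro x hx
    have : r x ≠ 0 := by linarith [(hp.density_mem x).1]
    rw [hρ x hx, h.integral_sq_mul_steady hS hx, (hfix x hx).2]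
    field_simp
  have hdev : ∀ x ∈ Icc (0 : ℝ) 1, |r x - 1| ≤ 14 * (K * ε) ∧ |θ x - 1| ≤ 30 * (K * ε) :=
    fun x hx => h.abs_profile_sub_le hp hx (hfix x hx).1 (hfix x hx).2
  refine ⟨steady κ T₁ T₂ (maxwellSource t r θ), _, _,
    h.steady_nonneg hS hp.maxwellSource_nonneg (hp.mass_maxwellSource ht),
    measurable_steady (hp.continuous_maxwellSource ht).measurable, rfl, rfl,
    h.isMildSteadyState ht hp hρ hTf fun _ _ => rfl, ?_, fun x hx => ?_, fun x hx => ?_, ?_,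
    fun x hx => ?_⟩
  · rw [setIntegral_congr_fun measurableSet_Icc hρ, integral_Icc_eq_integral_Ioc,
      ← intervalIntegral.integral_of_le zero_le_one, hp.mass]
  · have h1 := abs_le.1 (hdev x hx).1
    simp only [hρ x hx]
    constructor <;> linarith
  · refine h.integral_mul_steady hS (fun y hy => ?_) hx
    rw [(hfix y hy).1, hp.integral_maxwellSource ht]
    ring
  · exact (continuous_const.mul hp.continuous_temp).continuousOn.congr hTf
  · have h1 := abs_le.1 (hdev x hx).1
    have h2 := abs_le.1 (hdev x hx).2
    simp only [hTf x hx]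
    simp only [hρ x hx]
    have hr := hp.density_mem x
    have hθ := hp.temp_mem x
    have h3 : t * (1 - 30 * K * ε) ≤ t * θ x := by gcongr; linarith
    have h4 : t * θ x ≤ t * (1 + 30 * K * ε) := by gcongr; linarith
    have h5 : (30 * K)⁻¹ ≤ 1 / 4 := by
      rw [inv_le_comm₀ (by linarith) (by norm_num)]
      linarith
    have h6 : r x * (t * θ x) = r x * θ x * t := by ring
    refine ⟨hlow.trans h3, h4.trans hup, h3, h4, ?_, ?_⟩
    · rw [h6]
      exact mul_le_mul_of_nonneg_right (by nlinarith [hr.1, hθ.1]) ht.le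
    · rw [h6]
      exact mul_le_mul_of_nonneg_right (by nlinarith [hr.1, hr.2, hθ.2]) ht.le
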